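/- arXiv:0803.3508 — 11 statements merged into one kernel-verified Lean document; each statement's English description precedes it below -/
import Mathlib

section
/- Let Ω ⊆ ℝⁿ be open and let φ : Ω → ℝ be smooth with ∇φ(x) ≠ 0 for all x ∈ Ω. Define a(x,ξ) = |ξ|² − |∇φ(x)|² and b(x,ξ) = 2⟨∇φ(x), ξ⟩. Then the following are equivalent: (i) the canonical Poisson bracket {a,b}(x,ξ) = Σⱼ (∂a/∂ξⱼ · ∂b/∂xⱼ − ∂a/∂xⱼ · ∂b/∂ξⱼ) vanishes at every (x,ξ) ∈ Ω × ℝⁿ with a(x,ξ) = b(x,ξ) = 0; (ii) for every x ∈ Ω and every X ∈ ℝⁿ with |X| = |∇φ(x)| and ⟨X, ∇φ(x)⟩ = 0 one has D²φ(x)(X,X) + D²φ(x)(∇φ(x), ∇φ(x)) = 0. -/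
open RealInnerProductSpace
noncomputable section

/-- The Hessian bilinear form of `φ` at `x`, i.e. the second (Fréchet) derivative
viewed as a bilinear form. -/
def Hess {n : ℕ} (φ : EuclideanSpace ℝ (Fin n) → ℝ) (x X Y : EuclideanSpace ℝ (Fin n)) : ℝ :=
  iteratedFDeriv ℝ 2 φ x ![X, Y]

/-- `φ` is a limiting Carleman weight on `Ω ⊆ ℝⁿ` (Euclidean metric): its gradient is
nonvanishing on `Ω` and for every `x ∈ Ω` and every `X` with `|X| = |∇φ(x)|` and
`⟨X, ∇φ(x)⟩ = 0` one has `D²φ(x)(X,X) + D²φ(x)(∇φ(x),∇φ(x)) = 0`. -/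
def IsLCW {n : ℕ} (Ω : Set (EuclideanSpace ℝ (Fin n))) (φ : EuclideanSpace ℝ (Fin n) → ℝ) :
    Prop :=
  (∀ x ∈ Ω, gradient φ x ≠ 0) ∧
  ∀ x ∈ Ω, ∀ X : EuclideanSpace ℝ (Fin n),
    ‖X‖ = ‖gradient φ x‖ → ⟪X, gradient φ x⟫ = 0 →
    Hess φ x X X + Hess φ x (gradient φ x) (gradient φ x) = 0

/-- The canonical Poisson bracket `{a,b}(x,ξ) = Σⱼ (∂a/∂ξⱼ ∂b/∂xⱼ − ∂a/∂xⱼ ∂b/∂ξⱼ)`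
of two symbols `a, b : ℝⁿ × ℝⁿ → ℝ`. -/
def PoissonBracket {n : ℕ}
    (a b : EuclideanSpace ℝ (Fin n) → EuclideanSpace ℝ (Fin n) → ℝ)
    (x ξ : EuclideanSpace ℝ (Fin n)) : ℝ :=
  ∑ j : Fin n,
    (fderiv ℝ (fun η => a x η) ξ (EuclideanSpace.single j 1) *
        fderiv ℝ (fun y => b y ξ) x (EuclideanSpace.single j 1) -
      fderiv ℝ (fun y => a y ξ) x (EuclideanSpace.single j 1) *
        fderiv ℝ (fun η => b x η) ξ (EuclideanSpace.single j 1))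

theorem sum_coord_mul_apply_single {n : ℕ} (L : EuclideanSpace ℝ (Fin n) →L[ℝ] ℝ)
    (v : EuclideanSpace ℝ (Fin n)) :
    ∑ j : Fin n, v j * L (EuclideanSpace.single j 1) = L v := by
  conv_rhs => rw [← (EuclideanSpace.basisFun (Fin n) ℝ).sum_repr v]
  simp

theorem inner_gradient_eq_fderiv {n : ℕ} (φ : EuclideanSpace ℝ (Fin n) → ℝ)
    (x v : EuclideanSpace ℝ (Fin n)) : ⟪gradient φ x, v⟫ = fderiv ℝ φ x v := by
  simp [gradient]

theorem Hess_eq_inner_fderiv_gradient {n : ℕ} {φ : EuclideanSpace ℝ (Fin n) → ℝ}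
    {x : EuclideanSpace ℝ (Fin n)} (hφ : DifferentiableAt ℝ (gradient φ) x)
    (v w : EuclideanSpace ℝ (Fin n)) :
    Hess φ x v w = ⟪fderiv ℝ (gradient φ) x v, w⟫ := by
  have h : fderiv ℝ φ = fun y => innerSL ℝ (gradient φ y) := by
    ext y u
    exact (inner_gradient_eq_fderiv φ y u).symm
  have hd : HasFDerivAt (fderiv ℝ φ)
      ((innerSL ℝ).comp (fderiv ℝ (gradient φ) x)) x := by
    rw [h]
    exact (innerSL ℝ (E := EuclideanSpace ℝ (Fin n))).hasFDerivAt.comp x hφ.hasFDerivAt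
  rw [Hess, iteratedFDeriv_two_apply, hd.fderiv]
  simp

theorem differentiableAt_gradient {n : ℕ} {φ : EuclideanSpace ℝ (Fin n) → ℝ}
    {x : EuclideanSpace ℝ (Fin n)} (hφ : ContDiffAt ℝ 2 φ x) :
    DifferentiableAt ℝ (gradient φ) x := by
  have h : DifferentiableAt ℝ (fderiv ℝ φ) x :=
    (hφ.fderiv_right (m := 1) (by norm_num)).differentiableAt (by norm_num)
  exact (InnerProductSpace.toDual ℝ
    (EuclideanSpace ℝ (Fin n))).symm.toContinuousLinearEquiv.differentiableAt.comp x h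

theorem poissonBracket_carleman_symbols {n : ℕ} {φ : EuclideanSpace ℝ (Fin n) → ℝ}
    {x : EuclideanSpace ℝ (Fin n)} (hφ : DifferentiableAt ℝ (gradient φ) x)
    (ξ : EuclideanSpace ℝ (Fin n)) :
    PoissonBracket (fun y η => ‖η‖ ^ 2 - ‖gradient φ y‖ ^ 2)
      (fun y η => 2 * ⟪gradient φ y, η⟫) x ξ =
      4 * (Hess φ x ξ ξ + Hess φ x (gradient φ x) (gradient φ x)) := by
  have hG := hφ.hasFDerivAt
  have haξ (v) : fderiv ℝ (fun η => ‖η‖ ^ 2 - ‖gradient φ x‖ ^ 2) ξ v = 2 * ⟪ξ, v⟫ := by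
    have h : HasFDerivAt (fun η => ‖η‖ ^ 2 - ‖gradient φ x‖ ^ 2) _ ξ :=
      (hasFDerivAt_id ξ).norm_sq.sub_const _
    rw [h.fderiv]
    simp
  have hax (v) : fderiv ℝ (fun y => ‖ξ‖ ^ 2 - ‖gradient φ y‖ ^ 2) x v =
      -(2 * ⟪gradient φ x, fderiv ℝ (gradient φ) x v⟫) := by
    rw [(hG.norm_sq.const_sub _).fderiv]
    simp
  have hbx (v) : fderiv ℝ (fun y => 2 * ⟪gradient φ y, ξ⟫) x v =
      2 * ⟪fderiv ℝ (gradient φ) x v, ξ⟫ := by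
    rw [((hG.inner ℝ (hasFDerivAt_const ξ x)).const_mul 2).fderiv]
    simp
  have hbξ (v) : fderiv ℝ (fun η => 2 * ⟪gradient φ x, η⟫) ξ v = 2 * ⟪gradient φ x, v⟫ := by
    have h : HasFDerivAt (fun η => 2 * ⟪gradient φ x, η⟫) _ ξ :=
      (innerSL ℝ (gradient φ x)).hasFDerivAt.const_mul 2
    rw [h.fderiv]
    simp
  have key (u : EuclideanSpace ℝ (Fin n)) :
      ∑ j : Fin n, u j * ⟪u, fderiv ℝ (gradient φ) x (EuclideanSpace.single j 1)⟫ =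
        Hess φ x u u := by
    rw [Hess_eq_inner_fderiv_gradient hφ, real_inner_comm]
    exact sum_coord_mul_apply_single ((innerSL ℝ u).comp (fderiv ℝ (gradient φ) x)) u
  rw [← key, ← key, mul_add, Finset.mul_sum, Finset.mul_sum, ← Finset.sum_add_distrib,
    PoissonBracket]
  refine Finset.sum_congr rfl fun j _ => ?_
  rw [haξ, hax, hbx, hbξ, real_inner_comm ξ (fderiv ℝ (gradient φ) x _)]
  simp only [EuclideanSpace.inner_single_right, conj_trivial]
  ring

theorem statement1 {n : ℕ} (Ω : Set (EuclideanSpace ℝ (Fin n))) (hΩ : IsOpen Ω)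
    (φ : EuclideanSpace ℝ (Fin n) → ℝ) (hφ : ContDiffOn ℝ (⊤ : ℕ∞) φ Ω)
    (hgrad : ∀ x ∈ Ω, gradient φ x ≠ 0) :
    (∀ x ∈ Ω, ∀ ξ : EuclideanSpace ℝ (Fin n),
        ‖ξ‖ ^ 2 - ‖gradient φ x‖ ^ 2 = 0 → 2 * ⟪gradient φ x, ξ⟫ = 0 →
        PoissonBracket (fun y η => ‖η‖ ^ 2 - ‖gradient φ y‖ ^ 2)
          (fun y η => 2 * ⟪gradient φ y, η⟫) x ξ = 0) ↔
    (∀ x ∈ Ω, ∀ X : EuclideanSpace ℝ (Fin n),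
        ‖X‖ = ‖gradient φ x‖ → ⟪X, gradient φ x⟫ = 0 →
        Hess φ x X X + Hess φ x (gradient φ x) (gradient φ x) = 0) := by
  have hbr {x} (hx : x ∈ Ω) := poissonBracket_carleman_symbols (differentiableAt_gradient
    ((hφ.contDiffAt (hΩ.mem_nhds hx)).of_le (WithTop.coe_le_coe.mpr (le_top : (2 : ℕ∞) ≤ ⊤))))
  constructor
  · intro h x hx X hX hXg
    have h0 := h x hx X (by rw [hX, sub_self]) (by rw [real_inner_comm, hXg, mul_zero])
    rw [hbr hx] at h0
    linarith
  · intro h x hx ξ ha hb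
    have hn : ‖ξ‖ = ‖gradient φ x‖ :=
      (sq_eq_sq₀ (norm_nonneg _) (norm_nonneg _)).mp (sub_eq_zero.mp ha)
    have hi : ⟪ξ, gradient φ x⟫ = 0 := by
      rw [real_inner_comm]
      linarith
    rw [hbr hx, h x hx ξ hn hi, mul_zero]
end
end

section
/- Let Ω ⊆ ℝ² be open and let φ : Ω → ℝ be smooth with ∇φ(x) ≠ 0 for all x ∈ Ω. Then φ is a limiting Carleman weight on Ω if and only if φ is harmonic on Ω, i.e. Δφ(x) = 0 for all x ∈ Ω. -/
open RealInnerProductSpace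
noncomputable section

/-- In the plane, the sum of the Hessian over an orthogonal pair of vectors of equal nonzero length is
the squared length times the trace over the standard basis. -/
lemma hess_self_add_hess_self_eq_norm_sq_mul_sum (φ : EuclideanSpace ℝ (Fin 2) → ℝ)
    (x : EuclideanSpace ℝ (Fin 2)) {X g : EuclideanSpace ℝ (Fin 2)} (hg : g ≠ 0)
    (hnorm : ‖X‖ = ‖g‖) (horth : ⟪X, g⟫ = 0) :
    Hess φ x X X + Hess φ x g g =
      ‖g‖ ^ 2 * ∑ j : Fin 2,
        Hess φ x (EuclideanSpace.single j 1) (EuclideanSpace.single j 1) := by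
  have decomp (v : EuclideanSpace ℝ (Fin 2)) :
      v = v 0 • EuclideanSpace.single 0 1 + v 1 • EuclideanSpace.single 1 1 := by
    ext i; fin_cases i <;> simp
  have hess_self (v : EuclideanSpace ℝ (Fin 2)) : Hess φ x v v =
      v 0 ^ 2 * Hess φ x (EuclideanSpace.single 0 1) (EuclideanSpace.single 0 1) +
      v 0 * v 1 * (Hess φ x (EuclideanSpace.single 0 1) (EuclideanSpace.single 1 1) +
        Hess φ x (EuclideanSpace.single 1 1) (EuclideanSpace.single 0 1)) +
      v 1 ^ 2 * Hess φ x (EuclideanSpace.single 1 1) (EuclideanSpace.single 1 1) := by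
    conv_lhs => rw [decomp v]
    simp only [Hess, iteratedFDeriv_two_apply, Matrix.cons_val_zero, Matrix.cons_val_one,
      map_add, map_smul, add_apply, smul_apply, smul_eq_mul]
    ring
  have hgsq : ‖g‖ ^ 2 = g 0 ^ 2 + g 1 ^ 2 := by
    simp [EuclideanSpace.norm_sq_eq, Fin.sum_univ_two]
  have hXsq : X 0 ^ 2 + X 1 ^ 2 = g 0 ^ 2 + g 1 ^ 2 := by
    rw [← hgsq, ← hnorm]
    simp [EuclideanSpace.norm_sq_eq, Fin.sum_univ_two]
  have hdot : X 0 * g 0 + X 1 * g 1 = 0 := by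
    simpa [PiLp.inner_apply, Fin.sum_univ_two, mul_comm] using horth
  have hpos : g 0 ^ 2 + g 1 ^ 2 ≠ 0 := by
    rw [← hgsq]
    exact pow_ne_zero 2 (norm_ne_zero_iff.mpr hg)
  have h0 : X 0 ^ 2 = g 1 ^ 2 := by
    apply mul_left_cancel₀ hpos
    linear_combination (X 0 * g 0 - X 1 * g 1) * hdot + g 1 ^ 2 * hXsq
  have h1 : X 1 ^ 2 = g 0 ^ 2 := by linarith
  have h01 : X 0 * X 1 = -(g 0 * g 1) := by
    apply mul_left_cancel₀ hpos
    linear_combination (X 1 * g 0 + X 0 * g 1) * hdot - g 0 * g 1 * hXsq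
  rw [hess_self X, hess_self g, hgsq, Fin.sum_univ_two, h0, h1, h01]
  ring

theorem statement4 (Ω : Set (EuclideanSpace ℝ (Fin 2))) (hΩ : IsOpen Ω)
    (φ : EuclideanSpace ℝ (Fin 2) → ℝ) (hφ : ContDiffOn ℝ (⊤ : ℕ∞) φ Ω)
    (hgrad : ∀ x ∈ Ω, gradient φ x ≠ 0) :
    IsLCW Ω φ ↔
    ∀ x ∈ Ω, ∑ j : Fin 2,
        Hess φ x (EuclideanSpace.single j 1) (EuclideanSpace.single j 1) = 0 := by
  refine ⟨fun h x hx ↦ ?_, fun h ↦ ⟨hgrad, fun x hx X hnorm horth ↦ ?_⟩⟩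
  · set g := gradient φ x
    let X : EuclideanSpace ℝ (Fin 2) := !₂[-g 1, g 0]
    have hnorm : ‖X‖ = ‖g‖ := by
      simp [X, EuclideanSpace.norm_eq, Fin.sum_univ_two, add_comm]
    have horth : ⟪X, g⟫ = 0 := by
      simp [X, PiLp.inner_apply, Fin.sum_univ_two, mul_comm]
    have hsum := h.2 x hx X hnorm horth
    rw [hess_self_add_hess_self_eq_norm_sq_mul_sum φ x (hgrad x hx) hnorm horth] at hsum
    exact (mul_eq_zero.mp hsum).resolve_left
      (pow_ne_zero 2 (norm_ne_zero_iff.mpr (hgrad x hx)))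
  · rw [hess_self_add_hess_self_eq_norm_sq_mul_sum φ x (hgrad x hx) hnorm horth, h x hx, mul_zero]
end
end

section
/- Let Ω, Ω′ ⊆ ℝⁿ be open, let φ : Ω → ℝ be a smooth limiting Carleman weight on Ω, and let f : Ω′ → ℝⁿ be a smooth map with f(Ω′) ⊆ Ω which is conformal at every point of Ω′ (i.e. for each x ∈ Ω′ the derivative of f at x is a nonzero scalar multiple of a linear isometry of ℝⁿ). Then φ ∘ f is a smooth limiting Carleman weight on Ω′. -/
open RealInnerProductSpace
noncomputable section

open Filter Topology

section SecondDerivative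

variable {E F G : Type*} [NormedAddCommGroup E] [NormedSpace ℝ E]
  [NormedAddCommGroup F] [NormedSpace ℝ F] [NormedAddCommGroup G] [NormedSpace ℝ G]

/-- The chain rule for the second derivative of a composition. -/
theorem fderiv_fderiv_comp_apply {g : F → G} {f : E → F} {x : E}
    (hg : ContDiffAt ℝ 2 g (f x)) (hf : ContDiffAt ℝ 2 f x) (u v : E) :
    fderiv ℝ (fderiv ℝ (g ∘ f)) x u v =
      fderiv ℝ (fderiv ℝ g) (f x) (fderiv ℝ f x u) (fderiv ℝ f x v) +
        fderiv ℝ g (f x) (fderiv ℝ (fderiv ℝ f) x u v) := by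
  have hg_ev : ∀ᶠ y in 𝓝 x, DifferentiableAt ℝ g (f y) :=
    hf.continuousAt.eventually
      ((hg.eventually (by simp)).mono fun y hy => hy.differentiableAt (by simp))
  have hf_ev : ∀ᶠ y in 𝓝 x, DifferentiableAt ℝ f y :=
    (hf.eventually (by simp)).mono fun y hy => hy.differentiableAt (by simp)
  have h_eq : fderiv ℝ (g ∘ f) =ᶠ[𝓝 x] fun y => (fderiv ℝ g (f y)).comp (fderiv ℝ f y) := by
    filter_upwards [hg_ev, hf_ev] with y hgy hfy using fderiv_comp y hgy hfy
  have hg' : DifferentiableAt ℝ (fderiv ℝ g) (f x) :=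
    (hg.fderiv_right (m := 1) (by norm_num)).differentiableAt (by simp)
  have hf' : DifferentiableAt ℝ (fderiv ℝ f) x :=
    (hf.fderiv_right (m := 1) (by norm_num)).differentiableAt (by simp)
  have h := (hg'.hasFDerivAt.comp x hf_ev.self_of_nhds.hasFDerivAt).clm_comp hf'.hasFDerivAt
  rw [h_eq.fderiv_eq]
  erw [h.fderiv]
  simp [add_comm]

end SecondDerivative

section Conformal

variable {E F : Type*} [NormedAddCommGroup E] [InnerProductSpace ℝ E]
  [NormedAddCommGroup F] [InnerProductSpace ℝ F]

/-- The second derivative of a conformal map satisfies `⟪Df v, D²f(u, u) + D²f(v, v)⟫ = 0`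
whenever `u` and `v` are orthogonal and of the same length. -/
theorem inner_fderiv_fderiv_add_eq_zero_of_conformal {f : E → F} {x : E}
    (hf : ContDiffAt ℝ 2 f x) (hconf : ∀ᶠ y in 𝓝 x, IsConformalMap (fderiv ℝ f y))
    {u v : E} (h_norm : ‖u‖ = ‖v‖) (h_orth : ⟪u, v⟫ = 0) :
    ⟪fderiv ℝ f x v, fderiv ℝ (fderiv ℝ f) x u u + fderiv ℝ (fderiv ℝ f) x v v⟫ = 0 := by
  have hf' : HasFDerivAt (fderiv ℝ f) (fderiv ℝ (fderiv ℝ f) x) x :=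
    ((hf.fderiv_right (m := 1) (by norm_num)).differentiableAt (by simp)).hasFDerivAt
  have h_apply (w : E) : HasFDerivAt (fun y => fderiv ℝ f y w)
      ((fderiv ℝ (fderiv ℝ f) x).flip w) x := by
    simpa using hf'.clm_apply (hasFDerivAt_const w x)
  have h_orth_ev : (fun y => ⟪fderiv ℝ f y u, fderiv ℝ f y v⟫) =ᶠ[𝓝 x] fun _ => (0 : ℝ) := by
    filter_upwards [hconf] with y hy
    obtain ⟨c, -, hc⟩ := (isConformalMap_iff _).1 hy
    rw [hc, h_orth, mul_zero]
  have h_norm_ev : (fun y => ⟪fderiv ℝ f y u, fderiv ℝ f y u⟫ -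
      ⟪fderiv ℝ f y v, fderiv ℝ f y v⟫) =ᶠ[𝓝 x] fun _ => (0 : ℝ) := by
    filter_upwards [hconf] with y hy
    obtain ⟨c, -, hc⟩ := (isConformalMap_iff _).1 hy
    rw [hc, hc, real_inner_self_eq_norm_sq, real_inner_self_eq_norm_sq, h_norm, sub_self]
  have h₁ := DFunLike.congr_fun
    (((h_apply u).inner ℝ (h_apply v)).unique
      ((hasFDerivAt_const (0 : ℝ) x).congr_of_eventuallyEq h_orth_ev)) u
  have h₂ := DFunLike.congr_fun
    ((((h_apply u).inner ℝ (h_apply u)).sub ((h_apply v).inner ℝ (h_apply v))).unique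
      ((hasFDerivAt_const (0 : ℝ) x).congr_of_eventuallyEq h_norm_ev)) v
  have h_symm : fderiv ℝ (fderiv ℝ f) x v u = fderiv ℝ (fderiv ℝ f) x u v :=
    (hf.isSymmSndFDerivAt (by simp)).eq v u
  simp [fderivInnerCLM_apply, h_symm] at h₁ h₂
  rw [inner_add_right]
  rw [real_inner_comm (fderiv ℝ f x v)] at h₁ h₂
  rw [real_inner_comm (fderiv ℝ f x u)] at h₂
  linarith

end Conformal

theorem Hess_eq_fderiv_fderiv {n : ℕ} (φ : EuclideanSpace ℝ (Fin n) → ℝ)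
    (x X Y : EuclideanSpace ℝ (Fin n)) : Hess φ x X Y = fderiv ℝ (fderiv ℝ φ) x X Y := by
  simp [Hess, iteratedFDeriv_two_apply]

/-- The gradient pulls back along a map whose derivative is `c` times a linear isometry. -/
theorem map_gradient_comp_of_fderiv_eq_smul {n : ℕ} {φ : EuclideanSpace ℝ (Fin n) → ℝ}
    {f : EuclideanSpace ℝ (Fin n) → EuclideanSpace ℝ (Fin n)} {x : EuclideanSpace ℝ (Fin n)}
    (hφ : DifferentiableAt ℝ φ (f x)) (hf : DifferentiableAt ℝ f x) {c : ℝ}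
    {L : EuclideanSpace ℝ (Fin n) →ₗᵢ[ℝ] EuclideanSpace ℝ (Fin n)}
    (hL : fderiv ℝ f x = c • L.toContinuousLinearMap) :
    L (gradient (φ ∘ f) x) = c • gradient φ (f x) := by
  have h_inner (ψ : EuclideanSpace ℝ (Fin n) → ℝ) (y w : EuclideanSpace ℝ (Fin n)) :
      ⟪gradient ψ y, w⟫ = fderiv ℝ ψ y w := by
    simp [gradient]
  refine ext_inner_right ℝ fun w => ?_
  obtain ⟨v, rfl⟩ := LinearMap.injective_iff_surjective.1 L.injective w
  change ⟪L _, L v⟫ = ⟪_, L v⟫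
  rw [L.inner_map_map, h_inner, fderiv_comp x hφ hf, hL, real_inner_smul_left, h_inner]
  simp

theorem statement5 {n : ℕ} (Ω Ω' : Set (EuclideanSpace ℝ (Fin n)))
    (hΩ : IsOpen Ω) (hΩ' : IsOpen Ω')
    (φ : EuclideanSpace ℝ (Fin n) → ℝ) (hφ : ContDiffOn ℝ (⊤ : ℕ∞) φ Ω)
    (hlcw : IsLCW Ω φ)
    (f : EuclideanSpace ℝ (Fin n) → EuclideanSpace ℝ (Fin n))
    (hf : ContDiffOn ℝ (⊤ : ℕ∞) f Ω') (hmaps : Set.MapsTo f Ω' Ω)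
    (hconf : ∀ x ∈ Ω', IsConformalMap (fderiv ℝ f x)) :
    ContDiffOn ℝ (⊤ : ℕ∞) (φ ∘ f) Ω' ∧ IsLCW Ω' (φ ∘ f) := by
  have hle : (2 : WithTop ℕ∞) ≤ ((⊤ : ℕ∞) : WithTop ℕ∞) :=
    WithTop.coe_le_coe.2 (le_top : (2 : ℕ∞) ≤ ⊤)
  refine ⟨hφ.comp hf hmaps, ?_, ?_⟩
  · intro x hx h_zero
    have hφx := (hφ.contDiffAt (hΩ.mem_nhds (hmaps hx))).of_le hle
    have hfx := (hf.contDiffAt (hΩ'.mem_nhds hx)).of_le hle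
    obtain ⟨c, hc, L, hL⟩ := hconf x hx
    have h_grad := map_gradient_comp_of_fderiv_eq_smul (hφx.differentiableAt (by simp))
      (hfx.differentiableAt (by simp)) hL
    rw [h_zero, map_zero] at h_grad
    exact (smul_ne_zero hc (hlcw.1 _ (hmaps hx))) h_grad.symm
  · intro x hx X h_norm h_orth
    have hφx := (hφ.contDiffAt (hΩ.mem_nhds (hmaps hx))).of_le hle
    have hfx := (hf.contDiffAt (hΩ'.mem_nhds hx)).of_le hle
    have h_second := inner_fderiv_fderiv_add_eq_zero_of_conformal hfx
      ((hΩ'.eventually_mem hx).mono hconf) h_norm h_orth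
    obtain ⟨c, hc, L, hL⟩ := hconf x hx
    have h_grad := map_gradient_comp_of_fderiv_eq_smul (hφx.differentiableAt (by simp))
      (hfx.differentiableAt (by simp)) hL
    have hX : fderiv ℝ f x X = (c * c) • (c⁻¹ • L X) := by
      rw [hL, smul_smul, mul_assoc, mul_inv_cancel₀ hc, mul_one]
      rfl
    have hY : fderiv ℝ f x (gradient (φ ∘ f) x) = (c * c) • gradient φ (f x) := by
      rw [hL, mul_smul, ← h_grad]
      rfl
    have h_norm' : ‖c⁻¹ • L X‖ = ‖gradient φ (f x)‖ := by
      rw [norm_smul, L.norm_map, h_norm, ← L.norm_map, h_grad, ← norm_smul, smul_smul,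
        inv_mul_cancel₀ hc, one_smul]
    have h_orth' : ⟪c⁻¹ • L X, gradient φ (f x)⟫ = 0 := by
      have h : gradient φ (f x) = c⁻¹ • L (gradient (φ ∘ f) x) := by
        rw [h_grad, smul_smul, inv_mul_cancel₀ hc, one_smul]
      rw [h, real_inner_smul_left, real_inner_smul_right, L.inner_map_map, h_orth]
      simp
    have h_hess := hlcw.2 (f x) (hmaps hx) _ h_norm' h_orth'
    have h_first : fderiv ℝ φ (f x) (fderiv ℝ (fderiv ℝ f) x X X) +
        fderiv ℝ φ (f x) (fderiv ℝ (fderiv ℝ f) x (gradient (φ ∘ f) x)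
          (gradient (φ ∘ f) x)) = 0 := by
      rw [hY, real_inner_smul_left] at h_second
      have h := (mul_eq_zero.1 h_second).resolve_left (mul_ne_zero hc hc)
      rw [← map_add]
      simpa [gradient] using h
    simp only [Hess_eq_fderiv_fderiv] at h_hess ⊢
    rw [fderiv_fderiv_comp_apply hφx hfx, fderiv_fderiv_comp_apply hφx hfx, hX, hY]
    generalize c⁻¹ • L X = Z at h_hess
    simp only [map_smul, smul_apply, smul_eq_mul]
    linear_combination (c * c) * (c * c) * h_hess + h_first
end
end

section
/- Let n ≥ 2 and let ξ ∈ ℝⁿ with ξ ≠ 0. Then: (1) the function x ↦ log |x| is a limiting Carleman weight on ℝⁿ \ {0}; (2) the function x ↦ ⟨x, ξ⟩ / |x|² is a limiting Carleman weight on ℝⁿ \ {0}; (3) the function x ↦ log(|x + ξ|² / |x − ξ|²) is a limiting Carleman weight on ℝⁿ \ {ξ, −ξ}. In particular each of these functions has nonvanishing gradient on the indicated open set. -/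
open RealInnerProductSpace
noncomputable section

section LimitingCarlemanWeights

variable {n : ℕ}

/-- If `G` is the gradient of `φ` near `x`, the Hessian of `φ` at `x` is given by the derivative
of `G`. -/
theorem Hess_eq_inner_of_hasGradientAt {φ : EuclideanSpace ℝ (Fin n) → ℝ}
    {G : EuclideanSpace ℝ (Fin n) → EuclideanSpace ℝ (Fin n)}
    {G' : EuclideanSpace ℝ (Fin n) →L[ℝ] EuclideanSpace ℝ (Fin n)}
    {x : EuclideanSpace ℝ (Fin n)} (hφ : ∀ᶠ y in nhds x, HasGradientAt φ (G y) y)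
    (hG : HasFDerivAt G G' x) (X Y : EuclideanSpace ℝ (Fin n)) :
    Hess φ x X Y = ⟪G' X, Y⟫ := by
  have hev : fderiv ℝ φ =ᶠ[nhds x] fun y => innerSL ℝ (G y) := by
    filter_upwards [hφ] with y hy
    ext z
    simp [hy.hasFDerivAt.fderiv]
  have hd : HasFDerivAt (fun y => innerSL ℝ (G y)) ((innerSL ℝ).comp G') x :=
    (innerSL ℝ).hasFDerivAt.comp x hG
  simp only [Hess, iteratedFDeriv_two_apply]
  rw [hev.fderiv_eq, hd.fderiv]
  simp

/-- A criterion for limiting Carleman weights in terms of an explicit gradient field. -/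
theorem isLCW_of_hasGradientAt {Ω : Set (EuclideanSpace ℝ (Fin n))} (hΩ : IsOpen Ω)
    {φ : EuclideanSpace ℝ (Fin n) → ℝ}
    {G : EuclideanSpace ℝ (Fin n) → EuclideanSpace ℝ (Fin n)}
    {G' : EuclideanSpace ℝ (Fin n) → EuclideanSpace ℝ (Fin n) →L[ℝ] EuclideanSpace ℝ (Fin n)}
    (hφ : ∀ x ∈ Ω, HasGradientAt φ (G x) x) (hG : ∀ x ∈ Ω, HasFDerivAt G (G' x) x)
    (hne : ∀ x ∈ Ω, ⟪G x, G x⟫ ≠ 0)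
    (hH : ∀ x ∈ Ω, ∀ X, ⟪X, X⟫ = ⟪G x, G x⟫ → ⟪X, G x⟫ = 0 →
      ⟪G' x X, X⟫ + ⟪G' x (G x), G x⟫ = 0) :
    IsLCW Ω φ := by
  refine ⟨fun x hx h => ?_, fun x hx X hX hXG => ?_⟩
  · rw [(hφ x hx).gradient] at h
    exact hne x hx (by simp [h])
  · rw [(hφ x hx).gradient] at hX hXG ⊢
    have hev : ∀ᶠ y in nhds x, HasGradientAt φ (G y) y := by
      filter_upwards [hΩ.mem_nhds hx] with y hy using hφ y hy
    rw [Hess_eq_inner_of_hasGradientAt hev (hG x hx), Hess_eq_inner_of_hasGradientAt hev (hG x hx)]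
    exact hH x hx X (by rw [real_inner_self_eq_norm_sq, real_inner_self_eq_norm_sq, hX]) hXG

theorem hasFDerivAt_inner_self_add (c x : EuclideanSpace ℝ (Fin n)) :
    HasFDerivAt (fun y : EuclideanSpace ℝ (Fin n) => ⟪y + c, y + c⟫)
      ((2 : ℝ) • innerSL ℝ (x + c)) x := by
  have h := (hasFDerivAt_id (𝕜 := ℝ) x).add_const c
  refine (h.inner ℝ h).congr_fderiv ?_
  ext z
  simp only [id_eq, ContinuousLinearMap.comp_apply, ContinuousLinearMap.prod_apply,
    fderivInnerCLM_apply, ContinuousLinearMap.id_apply, smul_apply, innerSL_apply_apply,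
    smul_eq_mul, real_inner_comm z (x + c)]
  ring

theorem hasFDerivAt_inv_inner_self_add {c x : EuclideanSpace ℝ (Fin n)}
    (hx : ⟪x + c, x + c⟫ ≠ 0) :
    HasFDerivAt (fun y : EuclideanSpace ℝ (Fin n) => (⟪y + c, y + c⟫)⁻¹)
      (-(2 * (⟪x + c, x + c⟫ ^ 2)⁻¹) • innerSL ℝ (x + c)) x := by
  refine ((hasDerivAt_inv hx).comp_hasFDerivAt x (hasFDerivAt_inner_self_add c x)).congr_fderiv ?_
  rw [smul_smul]
  congr 1
  ring

/-- The gradient of `log |y + c|`. -/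
theorem hasGradientAt_log_norm_add {c x : EuclideanSpace ℝ (Fin n)}
    (hx : ⟪x + c, x + c⟫ ≠ 0) :
    HasGradientAt (fun y : EuclideanSpace ℝ (Fin n) => Real.log ‖y + c‖)
      ((⟪x + c, x + c⟫)⁻¹ • (x + c)) x := by
  have heq : (fun y : EuclideanSpace ℝ (Fin n) => Real.log ‖y + c‖) =
      fun y => (1 / 2 : ℝ) * Real.log ⟪y + c, y + c⟫ := by
    funext y
    rw [real_inner_self_eq_norm_sq, Real.log_pow]
    push_cast
    ring
  rw [heq, hasGradientAt_iff_hasFDerivAt]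
  refine (((hasFDerivAt_inner_self_add c x).log hx).const_mul (1 / 2 : ℝ)).congr_fderiv ?_
  ext z
  simp
  ring

/-- The derivative of the gradient of `log |y + c|`. -/
theorem hasFDerivAt_gradient_log_norm_add {c x : EuclideanSpace ℝ (Fin n)}
    (hx : ⟪x + c, x + c⟫ ≠ 0) :
    HasFDerivAt (fun y : EuclideanSpace ℝ (Fin n) => (⟪y + c, y + c⟫)⁻¹ • (y + c))
      ((⟪x + c, x + c⟫)⁻¹ • ContinuousLinearMap.id ℝ (EuclideanSpace ℝ (Fin n)) +
        (-(2 * (⟪x + c, x + c⟫ ^ 2)⁻¹) • innerSL ℝ (x + c)).smulRight (x + c)) x :=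
  (hasFDerivAt_inv_inner_self_add hx).smul ((hasFDerivAt_id (𝕜 := ℝ) x).add_const c)

theorem isLCW_log_norm :
    IsLCW {x : EuclideanSpace ℝ (Fin n) | x ≠ 0} (fun x => Real.log ‖x‖) := by
  have h0 : ∀ x ∈ {x : EuclideanSpace ℝ (Fin n) | x ≠ 0}, ⟪x + 0, x + 0⟫ ≠ 0 :=
    fun x hx => inner_self_ne_zero.2 (by simpa using hx)
  have hφ := fun x hx => hasGradientAt_log_norm_add (h0 x hx)
  simp only [add_zero] at hφ
  have hG := fun x hx => hasFDerivAt_gradient_log_norm_add (h0 x hx)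
  simp only [add_zero] at hG h0
  refine isLCW_of_hasGradientAt isOpen_ne hφ hG (fun x hx => ?_) (fun x hx X hX hXG => ?_)
  · simpa using hx
  · have hu := h0 x hx
    simp only [inner_add_left, inner_smul_left, inner_smul_right, add_apply, smul_apply,
      ContinuousLinearMap.id_apply, ContinuousLinearMap.smulRight_apply, innerSL_apply_apply,
      conj_trivial, smul_eq_mul, real_inner_comm x X] at hX hXG ⊢
    generalize ⟪x, x⟫ = u at *
    have hxX : ⟪x, X⟫ = 0 := by simpa [hu, real_inner_comm] using hXG
    rw [hX]
    simp only [hxX]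
    field_simp
    ring

theorem isLCW_inner_div_norm_sq {ξ : EuclideanSpace ℝ (Fin n)} (hξ : ξ ≠ 0) :
    IsLCW {x : EuclideanSpace ℝ (Fin n) | x ≠ 0} (fun x => ⟪x, ξ⟫ / ‖x‖ ^ 2) := by
  have h0 : ∀ x ∈ {x : EuclideanSpace ℝ (Fin n) | x ≠ 0}, ⟪x + 0, x + 0⟫ ≠ 0 :=
    fun x hx => inner_self_ne_zero.2 (by simpa using hx)
  have hi := fun x hx => hasFDerivAt_inv_inner_self_add (h0 x hx)
  have hg := fun x hx => hasFDerivAt_gradient_log_norm_add (h0 x hx)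
  simp only [add_zero] at hi hg h0
  have hs : ∀ x : EuclideanSpace ℝ (Fin n),
      HasFDerivAt (fun y : EuclideanSpace ℝ (Fin n) => ⟪ξ, y⟫) (innerSL ℝ ξ) x :=
    fun x => (innerSL ℝ ξ).hasFDerivAt
  have hφ : ∀ x ∈ {x : EuclideanSpace ℝ (Fin n) | x ≠ 0},
      HasGradientAt (fun x => ⟪x, ξ⟫ / ‖x‖ ^ 2)
        ((⟪x, x⟫)⁻¹ • ξ - (2 * (⟪ξ, x⟫ * (⟪x, x⟫)⁻¹)) • ((⟪x, x⟫)⁻¹ • x)) x := by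
    intro x hx
    rw [hasGradientAt_iff_hasFDerivAt]
    simp only [← real_inner_self_eq_norm_sq, div_eq_mul_inv, real_inner_comm ξ]
    refine ((hs x).mul (hi x hx)).congr_fderiv ?_
    ext z
    simp
    ring
  have hG := fun x hx => ((hi x hx).smul_const ξ).sub
    ((((hs x).mul (hi x hx)).const_mul 2).smul (hg x hx))
  refine isLCW_of_hasGradientAt isOpen_ne hφ hG (fun x hx => ?_) (fun x hx X hX hXG => ?_)
  · have hu := h0 x hx
    have hw : ⟪ξ, ξ⟫ ≠ 0 := inner_self_ne_zero.2 hξ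
    simp only [inner_sub_left, inner_sub_right, inner_smul_left, inner_smul_right,
      conj_trivial, real_inner_comm ξ x]
    generalize ⟪x, x⟫ = u at *
    generalize ⟪ξ, ξ⟫ = w at *
    generalize ⟪ξ, x⟫ = s at *
    have : w * (u⁻¹) ^ 2 ≠ 0 := by positivity
    convert this using 1
    field_simp
    ring
  · have hu := h0 x hx
    simp only [inner_add_left, inner_sub_left, inner_sub_right, inner_smul_left, inner_smul_right,
      add_apply, sub_apply, smul_apply, Pi.mul_apply, ContinuousLinearMap.id_apply,
      ContinuousLinearMap.smulRight_apply, innerSL_apply_apply,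
      conj_trivial, smul_eq_mul, real_inner_comm x X, real_inner_comm ξ X,
      real_inner_comm ξ x] at hX hXG ⊢
    rw [hX]
    clear hX
    generalize ⟪x, x⟫ = u at *
    generalize ⟪ξ, ξ⟫ = w at *
    generalize ⟪ξ, x⟫ = s at *
    generalize ⟪x, X⟫ = p at *
    generalize ⟪ξ, X⟫ = q at *
    have hq : q = 2 * s * p / u := by
      field_simp at hXG ⊢
      linarith
    rw [hq]
    field_simp
    ring

theorem isLCW_log_norm_sq_div_norm_sq {ξ : EuclideanSpace ℝ (Fin n)} (hξ : ξ ≠ 0) :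
    IsLCW {x : EuclideanSpace ℝ (Fin n) | x ≠ ξ ∧ x ≠ -ξ}
      (fun x => Real.log (‖x + ξ‖ ^ 2 / ‖x - ξ‖ ^ 2)) := by
  have hopen : IsOpen {x : EuclideanSpace ℝ (Fin n) | x ≠ ξ ∧ x ≠ -ξ} := isOpen_ne.inter isOpen_ne
  have hA : ∀ x ∈ {x : EuclideanSpace ℝ (Fin n) | x ≠ ξ ∧ x ≠ -ξ}, ⟪x + ξ, x + ξ⟫ ≠ 0 :=
    fun x hx => inner_self_ne_zero.2 fun h => hx.2 (eq_neg_of_add_eq_zero_left h)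
  have hB : ∀ x ∈ {x : EuclideanSpace ℝ (Fin n) | x ≠ ξ ∧ x ≠ -ξ}, ⟪x + -ξ, x + -ξ⟫ ≠ 0 :=
    fun x hx => inner_self_ne_zero.2 fun h => hx.1 (by simpa using eq_neg_of_add_eq_zero_left h)
  have hφ : ∀ x ∈ {x : EuclideanSpace ℝ (Fin n) | x ≠ ξ ∧ x ≠ -ξ},
      HasGradientAt (fun x => Real.log (‖x + ξ‖ ^ 2 / ‖x - ξ‖ ^ 2))
        ((2 : ℝ) • ((⟪x + ξ, x + ξ⟫)⁻¹ • (x + ξ) - (⟪x + -ξ, x + -ξ⟫)⁻¹ • (x + -ξ))) x := by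
    intro x hx
    have h := ((hasGradientAt_log_norm_add (hA x hx)).hasFDerivAt.sub
      (hasGradientAt_log_norm_add (hB x hx)).hasFDerivAt).const_mul 2
    rw [hasGradientAt_iff_hasFDerivAt, map_smul, map_sub]
    refine h.congr_of_eventuallyEq ?_
    filter_upwards [hopen.mem_nhds hx] with y hy
    have hyA := hA y hy
    have hyB := hB y hy
    rw [real_inner_self_eq_norm_sq] at hyA hyB
    rw [sub_eq_add_neg, Real.log_div hyA hyB, Real.log_pow, Real.log_pow]
    push_cast
    simp only [Pi.sub_apply]
    ring
  have hG := fun x hx => ((hasFDerivAt_gradient_log_norm_add (hA x hx)).sub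
    (hasFDerivAt_gradient_log_norm_add (hB x hx))).const_smul (2 : ℝ)
  refine isLCW_of_hasGradientAt hopen hφ hG (fun x hx => ?_) (fun x hx X hX hXG => ?_)
  · have hu := hA x hx
    have hv := hB x hx
    have hw : ⟪(x + ξ) - (x + -ξ), (x + ξ) - (x + -ξ)⟫ ≠ 0 := by
      refine inner_self_ne_zero.2 ?_
      rw [add_sub_add_left_eq_sub, sub_neg_eq_add, ← two_smul ℝ ξ]
      exact smul_ne_zero two_ne_zero hξ
    generalize x + ξ = a at *
    generalize x + -ξ = b at *
    simp only [inner_sub_left, inner_sub_right, inner_smul_left, inner_smul_right,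
      conj_trivial, real_inner_comm b a] at hw ⊢
    generalize ⟪a, a⟫ = u at *
    generalize ⟪b, b⟫ = v at *
    generalize ⟪b, a⟫ = s at *
    have : 4 * (u⁻¹ * v⁻¹) * (u - s - (s - v)) ≠ 0 := by positivity
    convert this using 1
    field_simp
    ring
  · have hu := hA x hx
    have hv := hB x hx
    generalize x + ξ = a at *
    generalize x + -ξ = b at *
    simp only [inner_add_left, inner_sub_left, inner_sub_right, inner_smul_left, inner_smul_right,
      add_apply, sub_apply, smul_apply, ContinuousLinearMap.id_apply,
      ContinuousLinearMap.smulRight_apply, innerSL_apply_apply,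
      conj_trivial, smul_eq_mul, real_inner_comm a X, real_inner_comm b X,
      real_inner_comm b a] at hX hXG ⊢
    rw [hX]
    clear hX
    generalize ⟪a, a⟫ = u at *
    generalize ⟪b, b⟫ = v at *
    generalize ⟪b, a⟫ = s at *
    generalize ⟪a, X⟫ = p at *
    generalize ⟪b, X⟫ = q at *
    have hq : q = p * v / u := by
      field_simp at hXG ⊢
      linarith
    rw [hq]
    field_simp
    ring

end LimitingCarlemanWeights

theorem statement6 {n : ℕ} (hn : 2 ≤ n)
    (ξ : EuclideanSpace ℝ (Fin n)) (hξ : ξ ≠ 0) :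
    (ContDiffOn ℝ (⊤ : ℕ∞) (fun x : EuclideanSpace ℝ (Fin n) => Real.log ‖x‖)
        {x : EuclideanSpace ℝ (Fin n) | x ≠ 0} ∧
      IsLCW {x : EuclideanSpace ℝ (Fin n) | x ≠ 0}
        (fun x => Real.log ‖x‖)) ∧
    (ContDiffOn ℝ (⊤ : ℕ∞) (fun x : EuclideanSpace ℝ (Fin n) => ⟪x, ξ⟫ / ‖x‖ ^ 2)
        {x : EuclideanSpace ℝ (Fin n) | x ≠ 0} ∧
      IsLCW {x : EuclideanSpace ℝ (Fin n) | x ≠ 0}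
        (fun x => ⟪x, ξ⟫ / ‖x‖ ^ 2)) ∧
    (ContDiffOn ℝ (⊤ : ℕ∞)
        (fun x : EuclideanSpace ℝ (Fin n) => Real.log (‖x + ξ‖ ^ 2 / ‖x - ξ‖ ^ 2))
        {x : EuclideanSpace ℝ (Fin n) | x ≠ ξ ∧ x ≠ -ξ} ∧
      IsLCW {x : EuclideanSpace ℝ (Fin n) | x ≠ ξ ∧ x ≠ -ξ}
        (fun x => Real.log (‖x + ξ‖ ^ 2 / ‖x - ξ‖ ^ 2))) := by
  refine ⟨⟨?_, isLCW_log_norm⟩, ⟨?_, isLCW_inner_div_norm_sq hξ⟩,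
    ?_, isLCW_log_norm_sq_div_norm_sq hξ⟩
  · exact (contDiffOn_id.norm ℝ fun x hx => hx).log fun x hx => norm_ne_zero_iff.2 hx
  · exact (contDiffOn_id.inner ℝ contDiffOn_const).div (contDiffOn_id.norm_sq ℝ)
      fun x hx => pow_ne_zero 2 (norm_ne_zero_iff.2 hx)
  · have hA : ∀ x ∈ {x : EuclideanSpace ℝ (Fin n) | x ≠ ξ ∧ x ≠ -ξ}, ‖x + ξ‖ ^ 2 ≠ 0 :=
      fun x hx => pow_ne_zero 2 (norm_ne_zero_iff.2 fun h => hx.2 (eq_neg_of_add_eq_zero_left h))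
    have hB : ∀ x ∈ {x : EuclideanSpace ℝ (Fin n) | x ≠ ξ ∧ x ≠ -ξ}, ‖x - ξ‖ ^ 2 ≠ 0 :=
      fun x hx => pow_ne_zero 2 (norm_ne_zero_iff.2 (sub_ne_zero.2 hx.1))
    exact (((contDiffOn_id.add contDiffOn_const).norm_sq ℝ).div
      ((contDiffOn_id.sub contDiffOn_const).norm_sq ℝ) hB).log
      fun x hx => div_ne_zero (hA x hx) (hB x hx)
end
end

section
/- Let Ω ⊆ ℝⁿ be open and let φ : Ω → ℝ be a smooth limiting Carleman weight on Ω. For x ∈ Ω let w(x) ∈ ℝⁿ be the vector determined by ⟨w(x), Z⟩ = D²φ(x)(∇φ(x), Z) for all Z ∈ ℝⁿ, and let λ(x) = −|∇φ(x)|⁻² D²φ(x)(∇φ(x), ∇φ(x)). Then for all x ∈ Ω and all X, Y ∈ ℝⁿ: D²φ(x)(X, Y) = λ(x) ⟨X, Y⟩ + |∇φ(x)|⁻² ( ⟨∇φ(x), X⟩ ⟨w(x), Y⟩ + ⟨w(x), X⟩ ⟨∇φ(x), Y⟩ ), and moreover Δφ(x) = (n − 2) λ(x), where Δφ denotes the trace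 of the Hessian. -/
open RealInnerProductSpace
noncomputable section

/-- A symmetric bilinear form `B` satisfying `B X X + B g g = 0` for all `X` orthogonal to `g` with
`‖X‖ = ‖g‖` is determined by `g` and the vector `w` representing `B g`. -/
theorem bilin_eq_of_apply_add_apply_eq_zero {E : Type*} [NormedAddCommGroup E]
    [InnerProductSpace ℝ E] (B : E →ₗ[ℝ] E →ₗ[ℝ] ℝ) (hB : ∀ X Y, B X Y = B Y X) {g w : E}
    (hg : g ≠ 0) (h : ∀ X : E, ‖X‖ = ‖g‖ → ⟪X, g⟫ = 0 → B X X + B g g = 0)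
    (hw : ∀ Z, ⟪w, Z⟫ = B g Z) (X Y : E) :
    B X Y = (-(‖g‖ ^ 2)⁻¹ * B g g) * ⟪X, Y⟫ +
      (‖g‖ ^ 2)⁻¹ * (⟪g, X⟫ * ⟪w, Y⟫ + ⟪w, X⟫ * ⟪g, Y⟫) := by
  have hg' : ‖g‖ ≠ 0 := norm_ne_zero_iff.mpr hg
  have orth : ∀ P : E, ⟪P, g⟫ = 0 → B P P = -(‖g‖ ^ 2)⁻¹ * B g g * ‖P‖ ^ 2 := by
    intro P hP
    rcases eq_or_ne P 0 with rfl | hP0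
    · simp
    have hP' : ‖P‖ ≠ 0 := norm_ne_zero_iff.mpr hP0
    have := h ((‖g‖ / ‖P‖) • P)
      (by rw [norm_smul, norm_div, norm_norm, norm_norm, div_mul_cancel₀ _ hP'])
      (by rw [real_inner_smul_left, hP, mul_zero])
    simp only [map_smul, LinearMap.smul_apply, smul_eq_mul] at this
    field_simp at this ⊢
    linarith
  have diag : ∀ X : E, B X X = (-(‖g‖ ^ 2)⁻¹ * B g g) * ⟪X, X⟫ +
      (‖g‖ ^ 2)⁻¹ * (2 * ⟪g, X⟫ * B g X) := by
    intro X
    have hP := orth (X - (⟪g, X⟫ / ‖g‖ ^ 2) • g) (by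
      rw [inner_sub_left, real_inner_smul_left, real_inner_self_eq_norm_sq,
        real_inner_comm, div_mul_cancel₀ _ (pow_ne_zero 2 hg'), sub_self])
    rw [← real_inner_self_eq_norm_sq (X - _)] at hP
    simp only [map_sub, map_smul, LinearMap.sub_apply, LinearMap.smul_apply, smul_eq_mul,
      inner_sub_left, inner_sub_right, real_inner_smul_left, real_inner_smul_right,
      real_inner_comm g X, real_inner_self_eq_norm_sq g, hB X g] at hP
    field_simp at hP ⊢
    refine mul_left_cancel₀ (pow_ne_zero 2 hg') ?_
    linear_combination hP
  have hX := diag X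
  have hY := diag Y
  have hXY := diag (X + Y)
  simp only [map_add, LinearMap.add_apply, inner_add_left, inner_add_right, hB Y X,
    real_inner_comm X Y] at hXY
  rw [hw, hw]
  linarith

/-- The trace over an orthonormal basis of a form of the shape given by
`bilin_eq_of_apply_add_apply_eq_zero`. -/
theorem sum_basis_of_bilin_eq {ι E : Type*} [Fintype ι] [NormedAddCommGroup E]
    [InnerProductSpace ℝ E] (b : OrthonormalBasis ι ℝ E) {H : E → E → ℝ} {g w : E}
    (h : ∀ X Y, H X Y = (-(‖g‖ ^ 2)⁻¹ * H g g) * ⟪X, Y⟫ +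
      (‖g‖ ^ 2)⁻¹ * (⟪g, X⟫ * ⟪w, Y⟫ + ⟪w, X⟫ * ⟪g, Y⟫)) (hw : ⟪w, g⟫ = H g g) :
    ∑ j, H (b j) (b j) = ((Fintype.card ι : ℝ) - 2) * (-(‖g‖ ^ 2)⁻¹ * H g g) := by
  have hsum : ∑ j, ⟪w, b j⟫ * ⟪g, b j⟫ = H g g := by
    rw [← hw, ← b.sum_inner_mul_inner w g]
    exact Finset.sum_congr rfl fun j _ => by rw [real_inner_comm (b j) g]
  have hterm : ∀ j, H (b j) (b j) =
      -(‖g‖ ^ 2)⁻¹ * H g g + (‖g‖ ^ 2)⁻¹ * 2 * (⟪w, b j⟫ * ⟪g, b j⟫) := fun j => by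
    rw [h, real_inner_self_eq_norm_sq, b.norm_eq_one]
    ring
  simp only [hterm, Finset.sum_add_distrib, ← Finset.mul_sum, hsum, Finset.sum_const,
    Finset.card_univ, nsmul_eq_mul]
  ring

theorem statement7 {n : ℕ} (Ω : Set (EuclideanSpace ℝ (Fin n))) (hΩ : IsOpen Ω)
    (φ : EuclideanSpace ℝ (Fin n) → ℝ) (hφ : ContDiffOn ℝ (⊤ : ℕ∞) φ Ω)
    (hlcw : IsLCW Ω φ) :
    ∀ x ∈ Ω, ∀ w : EuclideanSpace ℝ (Fin n),
      (∀ Z : EuclideanSpace ℝ (Fin n), ⟪w, Z⟫ = Hess φ x (gradient φ x) Z) →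
      (∀ X Y : EuclideanSpace ℝ (Fin n),
          Hess φ x X Y =
            (-(‖gradient φ x‖ ^ 2)⁻¹ * Hess φ x (gradient φ x) (gradient φ x)) * ⟪X, Y⟫ +
              (‖gradient φ x‖ ^ 2)⁻¹ *
                (⟪gradient φ x, X⟫ * ⟪w, Y⟫ + ⟪w, X⟫ * ⟪gradient φ x, Y⟫)) ∧
        (∑ j : Fin n, Hess φ x (EuclideanSpace.single j 1) (EuclideanSpace.single j 1)) =
          ((n : ℝ) - 2) *
            (-(‖gradient φ x‖ ^ 2)⁻¹ * Hess φ x (gradient φ x) (gradient φ x)) := by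
  intro x hx w hw
  obtain ⟨hg, hX⟩ := hlcw
  have hsymm : IsSymmSndFDerivAt ℝ φ x :=
    (hφ.contDiffAt (hΩ.mem_nhds hx)).isSymmSndFDerivAt (by
      simpa using WithTop.coe_le_coe.mpr (le_top : (2 : ℕ∞) ≤ ⊤))
  have hH : ∀ X Y, Hess φ x X Y = (fderiv ℝ (fderiv ℝ φ) x).toLinearMap₁₂ X Y := fun X Y => by
    simp [Hess, iteratedFDeriv_two_apply]
  have key := bilin_eq_of_apply_add_apply_eq_zero (fderiv ℝ (fderiv ℝ φ) x).toLinearMap₁₂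
    (fun X Y => by simpa using hsymm X Y) (hg x hx)
    (fun X h₁ h₂ => by simpa only [hH] using hX x hx X h₁ h₂) (fun Z => by rw [hw, hH])
  simp only [← hH] at key
  exact ⟨key, by simpa using
    sum_basis_of_bilin_eq (EuclideanSpace.basisFun (Fin n) ℝ) key (hw _)⟩
end
end

section
/- Let Ω ⊆ ℝⁿ be open with n ≥ 3, and let φ : Ω → ℝ be a smooth limiting Carleman weight on Ω. Fix x ∈ Ω, let H : ℝⁿ → ℝⁿ be the symmetric linear map with ⟨H X, Y⟩ = D²φ(x)(X, Y) for all X, Y ∈ ℝⁿ, let w = H(∇φ(x)), λ = −|∇φ(x)|⁻² ⟨w, ∇φ(x)⟩, and κ = |w| / |∇φ(x)|. Then the characteristic polynomial of H equals (T − λ)^{n−2} (T − κ)(T + κ); equivalently, the eigenvalues of H, counted with multiplicity, are λ (with multiplicity n − 2), κ and −κ. -/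
open RealInnerProductSpace
noncomputable section

open Polynomial in
/-- The characteristic polynomial of an endomorphism `z ↦ f z • u + g z • v` of rank at most two. -/
lemma charpoly_smulRight_add_smulRight {R M : Type*} [CommRing R] [Nontrivial R] [AddCommGroup M]
    [Module R M] [Module.Free R M] [Module.Finite R M] (hd : 2 ≤ Module.finrank R M)
    (f g : M →ₗ[R] R) (u v : M) :
    LinearMap.charpoly (f.smulRight u + g.smulRight v) =
      X ^ (Module.finrank R M - 2) *
        (X ^ 2 - C (f u + g v) * X + C (f u * g v - f v * g u)) := by
  classical
  let b := Module.Free.chooseBasis R M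
  let c := Pi.basisFun R (Fin 2)
  let U : (Fin 2 → R) →ₗ[R] M :=
    (LinearMap.proj 0).smulRight u + (LinearMap.proj 1).smulRight v
  let V : M →ₗ[R] (Fin 2 → R) := LinearMap.pi ![f, g]
  have hUV : f.smulRight u + g.smulRight v = U ∘ₗ V := by
    ext z
    simp [U, V]
  have hVU : LinearMap.toMatrix c c (V ∘ₗ U) = !![f u, f v; g u, g v] := by
    ext i j
    fin_cases i <;> fin_cases j <;> simp [U, V, c]
  have hcard := Module.finrank_eq_card_basis b
  rw [← LinearMap.charpoly_toMatrix _ b, hUV, LinearMap.toMatrix_comp b c b,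
    Matrix.charpoly_mul_comm_of_le _ _ (by simpa [← hcard] using hd),
    ← LinearMap.toMatrix_comp c b c, hVU, Matrix.charpoly_fin_two, ← hcard]
  simp [Matrix.trace_fin_two, Matrix.det_fin_two]

/-- A symmetric operator whose quadratic form is `l ‖·‖²` on the orthogonal complement of `g` and
takes the value `-l ‖g‖²` at `g` is `l` plus an explicit operator of rank at most two. -/
lemma LinearMap.IsSymmetric.sub_smul_eq_smulRight_add {E : Type*} [NormedAddCommGroup E]
    [InnerProductSpace ℝ E] {H : E →ₗ[ℝ] E} (hs : H.IsSymmetric) {g : E} (hg : g ≠ 0) {l : ℝ}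
    (hgg : ⟪H g, g⟫ = -l * ‖g‖ ^ 2) (hQ : ∀ z, ⟪z, g⟫ = 0 → ⟪H z, z⟫ = l * ‖z‖ ^ 2) :
    H - l • (1 : Module.End ℝ E) =
      ((‖g‖ ^ 2)⁻¹ • innerₛₗ ℝ g).smulRight (H g - l • g) +
        ((‖g‖ ^ 2)⁻¹ • innerₛₗ ℝ (H g + l • g)).smulRight g := by
  have hN : ‖g‖ ^ 2 ≠ 0 := by positivity
  rw [← sub_eq_zero]
  refine (LinearMap.IsSymmetric.inner_map_self_eq_zero fun x y => ?_).1 fun x => ?_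
  · have h1 := hs x y
    have h2 : ⟪H g, y⟫ = ⟪y, H g⟫ := real_inner_comm _ _
    have h3 : ⟪g, y⟫ = ⟪y, g⟫ := real_inner_comm _ _
    have h4 : ⟪H g, x⟫ = ⟪x, H g⟫ := real_inner_comm _ _
    have h5 : ⟪g, x⟫ = ⟪x, g⟫ := real_inner_comm _ _
    simp [inner_sub_left, inner_add_left, inner_sub_right, inner_add_right, inner_smul_left,
      inner_smul_right, h1, h2, h3, h4, h5]
    ring
  · have key := hQ (x - ((‖g‖ ^ 2)⁻¹ * ⟪x, g⟫) • g) (by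
      rw [inner_sub_left, real_inner_smul_left, real_inner_self_eq_norm_sq]
      field_simp
      ring)
    have h1 : ⟪H x, g⟫ = ⟪x, H g⟫ := hs x g
    have h4 : ⟪H g, x⟫ = ⟪x, H g⟫ := real_inner_comm _ _
    have h5 : ⟪g, x⟫ = ⟪x, g⟫ := real_inner_comm _ _
    rw [← real_inner_self_eq_norm_sq (x - _)] at key
    simp only [map_sub, map_smul, inner_sub_left, inner_sub_right, real_inner_smul_left,
      real_inner_smul_right, h1, h4, h5, hgg, real_inner_self_eq_norm_sq g] at key
    simp only [LinearMap.sub_apply, LinearMap.add_apply, LinearMap.smul_apply,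
      LinearMap.smulRight_apply, Module.End.one_apply, innerₛₗ_apply_apply, smul_eq_mul,
      inner_sub_left, inner_add_left, real_inner_smul_left, h4, h5]
    field_simp at key ⊢
    linear_combination key

open Polynomial in
/-- The characteristic polynomial of a symmetric operator whose quadratic form is `l ‖·‖²` on the
orthogonal complement of `g` and takes the value `-l ‖g‖²` at `g`. -/
lemma LinearMap.IsSymmetric.charpoly_eq_of_inner_map_self_eq {E : Type*} [NormedAddCommGroup E]
    [InnerProductSpace ℝ E] [FiniteDimensional ℝ E] (hd : 2 ≤ Module.finrank ℝ E)
    {H : E →ₗ[ℝ] E} (hs : H.IsSymmetric) {g : E} (hg : g ≠ 0) {l : ℝ}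
    (hgg : ⟪H g, g⟫ = -l * ‖g‖ ^ 2) (hQ : ∀ z, ⟪z, g⟫ = 0 → ⟪H z, z⟫ = l * ‖z‖ ^ 2) :
    H.charpoly = (X - C l) ^ (Module.finrank ℝ E - 2) *
      (X - C (‖H g‖ / ‖g‖)) * (X + C (‖H g‖ / ‖g‖)) := by
  have hN : ‖g‖ ≠ 0 := norm_ne_zero_iff.2 hg
  have h := LinearMap.charpoly_sub_smul H l
  rw [hs.sub_smul_eq_smulRight_add hg hgg hQ, charpoly_smulRight_add_smulRight hd] at h
  have hgH : ⟪g, H g⟫ = -l * ‖g‖ ^ 2 := by rw [real_inner_comm, hgg]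
  have htr : ((‖g‖ ^ 2)⁻¹ • innerₛₗ ℝ g) (H g - l • g) +
      ((‖g‖ ^ 2)⁻¹ • innerₛₗ ℝ (H g + l • g)) g = -(2 * l) := by
    simp only [LinearMap.smul_apply, innerₛₗ_apply_apply, smul_eq_mul, inner_sub_right,
      inner_add_left, real_inner_smul_left, real_inner_smul_right, hgg, hgH,
      real_inner_self_eq_norm_sq]
    field_simp
    ring
  have hdet : ((‖g‖ ^ 2)⁻¹ • innerₛₗ ℝ g) (H g - l • g) *
        ((‖g‖ ^ 2)⁻¹ • innerₛₗ ℝ (H g + l • g)) g -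
      ((‖g‖ ^ 2)⁻¹ • innerₛₗ ℝ g) g *
        ((‖g‖ ^ 2)⁻¹ • innerₛₗ ℝ (H g + l • g)) (H g - l • g) =
      l ^ 2 - (‖H g‖ / ‖g‖) ^ 2 := by
    simp only [LinearMap.smul_apply, innerₛₗ_apply_apply, smul_eq_mul, inner_sub_right,
      inner_add_left, real_inner_smul_left, real_inner_smul_right, hgg, hgH,
      real_inner_self_eq_norm_sq, norm_smul, mul_pow, Real.norm_eq_abs, sq_abs]
    field_simp
    ring
  rw [htr, hdet] at h
  have h' := congrArg (fun p : ℝ[X] => p.comp (X - C l)) h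
  simp only [Polynomial.comp_assoc, Polynomial.add_comp, Polynomial.X_comp, Polynomial.C_comp,
    _root_.sub_add_cancel, Polynomial.comp_X, Polynomial.mul_comp, Polynomial.sub_comp,
    Polynomial.pow_comp] at h'
  rw [← h']
  simp only [map_neg, map_mul, map_sub, map_pow, map_ofNat]
  ring

open Polynomial in
theorem statement8 {n : ℕ} (hn : 3 ≤ n) (Ω : Set (EuclideanSpace ℝ (Fin n))) (hΩ : IsOpen Ω)
    (φ : EuclideanSpace ℝ (Fin n) → ℝ) (hφ : ContDiffOn ℝ (⊤ : ℕ∞) φ Ω)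
    (hlcw : IsLCW Ω φ) (x : EuclideanSpace ℝ (Fin n)) (hx : x ∈ Ω)
    (H : EuclideanSpace ℝ (Fin n) →ₗ[ℝ] EuclideanSpace ℝ (Fin n))
    (hH : ∀ X Y : EuclideanSpace ℝ (Fin n), ⟪H X, Y⟫ = Hess φ x X Y) :
    LinearMap.charpoly H =
      (X - C (-(‖gradient φ x‖ ^ 2)⁻¹ * ⟪H (gradient φ x), gradient φ x⟫)) ^ (n - 2) *
        (X - C (‖H (gradient φ x)‖ / ‖gradient φ x‖)) *
        (X + C (‖H (gradient φ x)‖ / ‖gradient φ x‖)) := by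
  have hg := hlcw.1 x hx
  have hLCW := hlcw.2 x hx
  have hsymm : IsSymmSndFDerivAt ℝ φ x :=
    (hφ.contDiffAt (hΩ.mem_nhds hx)).isSymmSndFDerivAt (by
      rw [minSmoothness_of_isRCLikeNormedField]
      exact WithTop.coe_le_coe.2 (le_top (a := (2 : ℕ∞))))
  have hs : H.IsSymmetric := fun y z => by
    rw [hH, real_inner_comm, hH, Hess, Hess, iteratedFDeriv_two_apply, iteratedFDeriv_two_apply]
    exact hsymm _ _
  have hN : ‖gradient φ x‖ ≠ 0 := norm_ne_zero_iff.2 hg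
  have key := hs.charpoly_eq_of_inner_map_self_eq (by simp; lia) hg
    (l := -(‖gradient φ x‖ ^ 2)⁻¹ * ⟪H (gradient φ x), gradient φ x⟫)
    (by field_simp) (fun z hz => ?_)
  · simpa only [finrank_euclideanSpace_fin] using key
  · rcases eq_or_ne z 0 with rfl | hz0
    · simp
    have hzN : ‖z‖ ≠ 0 := norm_ne_zero_iff.2 hz0
    have h := hLCW ((‖gradient φ x‖ / ‖z‖) • z)
      (by rw [norm_smul, norm_div, norm_norm, norm_norm]; field_simp)
      (by rw [real_inner_smul_left, hz, mul_zero])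
    rw [← hH, ← hH, map_smul, real_inner_smul_left, real_inner_smul_right] at h
    field_simp at h ⊢
    linear_combination h
end
end

section
/- Let Ω ⊆ ℝⁿ be open and let φ : Ω → ℝ be smooth with ∇φ(x) ≠ 0 for all x ∈ Ω. Then φ is a limiting Carleman weight on Ω if and only if the vector field V(x) = |∇φ(x)|⁻² ∇φ(x) is a conformal Killing field for the Euclidean metric, i.e. for every x ∈ Ω there exists γ(x) ∈ ℝ such that ⟨(DV(x))X, Y⟩ + ⟨X, (DV(x))Y⟩ = γ(x) ⟨X, Y⟩ for all X, Y ∈ ℝⁿ, where DV(x) denotes the (Fréchet) derivative of V at x. -/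
open RealInnerProductSpace
noncomputable section

/-- The gradient of a `C²` function is differentiable, and its derivative represents the Hessian. -/
theorem exists_hasFDerivAt_gradient {n : ℕ} {φ : EuclideanSpace ℝ (Fin n) → ℝ}
    {x : EuclideanSpace ℝ (Fin n)} (h : ContDiffAt ℝ 2 φ x) :
    ∃ G : EuclideanSpace ℝ (Fin n) →L[ℝ] EuclideanSpace ℝ (Fin n),
      HasFDerivAt (gradient φ) G x ∧ ∀ X Y, ⟪G X, Y⟫ = Hess φ x X Y := by
  have hd : DifferentiableAt ℝ (fderiv ℝ φ) x :=
    (h.fderiv_right (m := 1) (by norm_num)).differentiableAt (by norm_num)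
  let L : (EuclideanSpace ℝ (Fin n) →L[ℝ] ℝ) →L[ℝ] EuclideanSpace ℝ (Fin n) :=
    { toFun := (InnerProductSpace.toDual ℝ (EuclideanSpace ℝ (Fin n))).symm
      map_add' := map_add _
      map_smul' := fun c f => by simp
      cont := LinearIsometryEquiv.continuous _ }
  refine ⟨L.comp (fderiv ℝ (fderiv ℝ φ) x), L.hasFDerivAt.comp x hd.hasFDerivAt, fun X Y => ?_⟩
  simp [L, Hess, iteratedFDeriv_two_apply]

/-- The derivative of `‖g‖⁻² g` in terms of the derivative of `g`. -/
theorem inner_fderiv_inv_norm_sq_smul {E : Type*} [NormedAddCommGroup E] [InnerProductSpace ℝ E]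
    {g : E → E} {G : E →L[ℝ] E} {x : E} (hg : HasFDerivAt g G x) (hx : g x ≠ 0) (X Y : E) :
    ⟪fderiv ℝ (fun y => (‖g y‖ ^ 2)⁻¹ • g y) x X, Y⟫ =
      (‖g x‖ ^ 2)⁻¹ * ⟪G X, Y⟫ - 2 * ((‖g x‖ ^ 2)⁻¹) ^ 2 * ⟪G X, g x⟫ * ⟪g x, Y⟫ := by
  have hr : ‖g x‖ ^ 2 ≠ 0 := by simpa using hx
  have h := ((hasDerivAt_inv hr).comp_hasFDerivAt x hg.norm_sq).smul hg
  have h' : HasFDerivAt (fun y => (‖g y‖ ^ 2)⁻¹ • g y) _ x := h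
  rw [h'.fderiv]
  simp only [add_apply, smul_apply,
    ContinuousLinearMap.smulRight_apply, ContinuousLinearMap.comp_apply, innerSL_apply_apply,
    inner_add_left, real_inner_smul_left, Function.comp_apply, smul_eq_mul, nsmul_eq_mul,
    real_inner_comm (g x) (G X)]
  simp only [real_inner_comm]
  field_simp
  ring

/-- For a symmetric operator `G` and `p ≠ 0`, the pointwise Carleman condition on `p` is equivalent
to the conformality of the symmetrised derivative of `‖g‖⁻² g`, where `g = p` and `Dg = G`. -/
theorem carleman_iff_conformal {E : Type*} [NormedAddCommGroup E] [InnerProductSpace ℝ E]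
    (G : E →L[ℝ] E) (hG : ∀ X Y, ⟪G X, Y⟫ = ⟪G Y, X⟫) {p : E} (hp : p ≠ 0) :
    (∀ X : E, ‖X‖ = ‖p‖ → ⟪X, p⟫ = 0 → ⟪G X, X⟫ + ⟪G p, p⟫ = 0) ↔
    ∃ γ : ℝ, ∀ X Y : E,
      ((‖p‖ ^ 2)⁻¹ * ⟪G X, Y⟫ - 2 * ((‖p‖ ^ 2)⁻¹) ^ 2 * ⟪G X, p⟫ * ⟪p, Y⟫) +
        ((‖p‖ ^ 2)⁻¹ * ⟪G Y, X⟫ - 2 * ((‖p‖ ^ 2)⁻¹) ^ 2 * ⟪G Y, p⟫ * ⟪p, X⟫) = γ * ⟪X, Y⟫ := by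
  have hp' : ‖p‖ ≠ 0 := by simpa using hp
  have hpp : ⟪p, p⟫ = ‖p‖ ^ 2 := real_inner_self_eq_norm_sq p
  constructor
  · intro h
    have horth : ∀ Z : E, ⟪Z, p⟫ = 0 → ‖p‖ ^ 2 * ⟪G Z, Z⟫ = -⟪G p, p⟫ * ⟪Z, Z⟫ := by
      intro Z hZ
      rcases eq_or_ne Z 0 with rfl | hZ0
      · simp
      have hZn : ‖Z‖ ≠ 0 := by simpa using hZ0
      have := h ((‖p‖ / ‖Z‖) • Z) (by simp [norm_smul, hZn]) (by simp [real_inner_smul_left, hZ])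
      simp only [map_smul, real_inner_smul_left, real_inner_smul_right] at this
      rw [real_inner_self_eq_norm_sq]
      field_simp at this
      linear_combination this
    have hdiag : ∀ X : E, ‖p‖ ^ 2 * ⟪G X, X⟫ - 2 * ⟪G X, p⟫ * ⟪p, X⟫ = -⟪G p, p⟫ * ⟪X, X⟫ := by
      intro X
      have hXp : ⟪X, p⟫ = ⟪p, X⟫ := real_inner_comm _ _
      have hZ := horth (X - (⟪p, X⟫ / ‖p‖ ^ 2) • p) (by
        rw [inner_sub_left, real_inner_smul_left, hpp, hXp]
        field_simp
        ring)
      simp only [map_sub, map_smul, inner_sub_left, inner_sub_right, real_inner_smul_left,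
        real_inner_smul_right, hpp, hXp, hG p X] at hZ
      field_simp at hZ
      have hp2 : ‖p‖ ^ 2 ≠ 0 := pow_ne_zero 2 hp'
      apply mul_left_cancel₀ hp2
      linear_combination hZ
    refine ⟨-2 * ⟪G p, p⟫ / (‖p‖ ^ 2) ^ 2, fun X Y => ?_⟩
    have hX := hdiag X
    have hY := hdiag Y
    have hXY := hdiag (X + Y)
    simp only [map_add, inner_add_left, inner_add_right, real_inner_comm X Y, hG Y X] at hXY
    rw [hG Y X]
    field_simp
    linear_combination hXY - hX - hY
  · rintro ⟨γ, h⟩ X hX hXp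
    have h1 := h p p
    have h2 := h X X
    rw [real_inner_comm] at hXp
    rw [real_inner_self_eq_norm_sq, hX, hXp] at h2
    rw [hpp] at h1
    field_simp at h1 h2
    apply mul_left_cancel₀ (pow_ne_zero 2 hp')
    linear_combination (h2 - ‖p‖ ^ 2 * h1) / 2

theorem statement9 {n : ℕ} (Ω : Set (EuclideanSpace ℝ (Fin n))) (hΩ : IsOpen Ω)
    (φ : EuclideanSpace ℝ (Fin n) → ℝ) (hφ : ContDiffOn ℝ (⊤ : ℕ∞) φ Ω)
    (hgrad : ∀ x ∈ Ω, gradient φ x ≠ 0) :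
    IsLCW Ω φ ↔
    ∀ x ∈ Ω, ∃ γ : ℝ, ∀ X Y : EuclideanSpace ℝ (Fin n),
      ⟪fderiv ℝ (fun y => (‖gradient φ y‖ ^ 2)⁻¹ • gradient φ y) x X, Y⟫ +
        ⟪X, fderiv ℝ (fun y => (‖gradient φ y‖ ^ 2)⁻¹ • gradient φ y) x Y⟫ =
        γ * ⟪X, Y⟫ := by
  have main : ∀ x ∈ Ω,
      (∀ X : EuclideanSpace ℝ (Fin n), ‖X‖ = ‖gradient φ x‖ → ⟪X, gradient φ x⟫ = 0 →
        Hess φ x X X + Hess φ x (gradient φ x) (gradient φ x) = 0) ↔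
      ∃ γ : ℝ, ∀ X Y : EuclideanSpace ℝ (Fin n),
        ⟪fderiv ℝ (fun y => (‖gradient φ y‖ ^ 2)⁻¹ • gradient φ y) x X, Y⟫ +
          ⟪X, fderiv ℝ (fun y => (‖gradient φ y‖ ^ 2)⁻¹ • gradient φ y) x Y⟫ =
          γ * ⟪X, Y⟫ := by
    intro x hx
    have h2 : ContDiffAt ℝ 2 φ x :=
      (hφ.contDiffAt (hΩ.mem_nhds hx)).of_le (WithTop.coe_le_coe.2 le_top)
    obtain ⟨G, hG, hH⟩ := exists_hasFDerivAt_gradient h2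
    have hsymm : ∀ X Y, ⟪G X, Y⟫ = ⟪G Y, X⟫ := by
      intro X Y
      simpa [hH, Hess, iteratedFDeriv_two_apply] using h2.isSymmSndFDerivAt (by simp) X Y
    simp_rw [← hH, real_inner_comm (fderiv ℝ _ x _) _,
      inner_fderiv_inv_norm_sq_smul hG (hgrad x hx)]
    exact carleman_iff_conformal G hsymm (hgrad x hx)
  exact ⟨fun h x hx => (main x hx).1 (h.2 x hx),
    fun h => ⟨hgrad, fun x hx => (main x hx).2 (h x hx)⟩⟩
end
end

section
/- Let n ≥ 3, let Ω ⊆ ℝⁿ be open, and let φ : Ω → ℝ be a smooth limiting Carleman weight on Ω. Then for every t ∈ ℝ, every connected component S of the level set φ⁻¹(t) is contained either in an affine hyperplane or in a sphere { x : |x − α| = r } for some α ∈ ℝⁿ and r > 0. -/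
open RealInnerProductSpace
noncomputable section

open Filter Topology

section LevelSets

variable {E F : Type*} [NormedAddCommGroup E] [NormedSpace ℝ E] [CompleteSpace E]
  [NormedAddCommGroup F] [NormedSpace ℝ F]

/-- A map whose derivative vanishes on the tangent spaces of the level sets of a submersion `φ` is
locally constant on these level sets. -/
theorem eventually_eq_of_fderiv_eq_zero_on_ker {φ : E → ℝ} {f : E → F} {a : E}
    (hφ : ContDiffAt ℝ 1 φ a) (ha : fderiv ℝ φ a ≠ 0)
    (hf : ∀ᶠ x in 𝓝 a, DifferentiableAt ℝ f x ∧
      ∀ X, fderiv ℝ φ x X = 0 → fderiv ℝ f x X = 0) :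
    ∀ᶠ x in 𝓝 a, φ x = φ a → f x = f a := by
  obtain ⟨w, hw⟩ : ∃ w, fderiv ℝ φ a w ≠ 0 := by
    by_contra! h
    exact ha (ContinuousLinearMap.ext h)
  set L := fderiv ℝ φ a with hL
  obtain ⟨v, hv⟩ : ∃ v, L v = 1 := ⟨(L w)⁻¹ • w, by simp [hw]⟩
  set Ψ : E → E := fun x => x + (φ x - φ a - L (x - a)) • v with hΨ
  have hΨa : Ψ a = a := by simp [hΨ]
  have hLΨ : ∀ x, L (Ψ x - a) = φ x - φ a := by
    intro x
    simp only [hΨ, map_sub, map_add, map_smul, hv, smul_eq_mul]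
    ring
  have hΨd : HasStrictFDerivAt Ψ ((ContinuousLinearEquiv.refl ℝ E : E ≃L[ℝ] E) : E →L[ℝ] E) a := by
    have h1 : HasStrictFDerivAt φ L a := hφ.hasStrictFDerivAt one_ne_zero
    have h2 := (hasStrictFDerivAt_id a).add
      (((h1.sub_const (φ a)).sub
        (L.hasStrictFDerivAt.comp a ((hasStrictFDerivAt_id a).sub_const a))).smul_const v)
    refine h2.congr_fderiv ?_
    ext x
    simp
  have hΨc : ContDiffAt ℝ 1 Ψ a := by
    have : ContDiff ℝ 1 fun x => L (x - a) := L.contDiff.comp (contDiff_id.sub contDiff_const)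
    exact contDiffAt_id.add (((hφ.sub contDiffAt_const).sub this.contDiffAt).smul contDiffAt_const)
  set G : E → E := hΨd.localInverse Ψ _ a with hG
  have hGc : ContDiffAt ℝ 1 G a := by
    have := hΨc.to_localInverse hΨd.hasFDerivAt one_ne_zero
    rwa [hΨa] at this
  have hleft : ∀ᶠ x in 𝓝 a, G (Ψ x) = x := hΨd.eventually_left_inverse
  have hright : ∀ᶠ y in 𝓝 a, Ψ (G y) = y := by
    have := hΨd.eventually_right_inverse
    rwa [hΨa] at this
  have hGa : G a = a := by
    have := hleft.self_of_nhds
    rwa [hΨa] at this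
  have hGt : Tendsto G (𝓝 a) (𝓝 a) := by
    have := hGc.continuousAt.tendsto
    rwa [hGa] at this
  have hΨt : Tendsto Ψ (𝓝 a) (𝓝 a) := by
    have := hΨc.continuousAt.tendsto
    rwa [hΨa] at this
  have hφG : ∀ᶠ y in 𝓝 a, φ (G y) = φ a + L (y - a) := by
    filter_upwards [hright] with y hy
    have := hLΨ (G y)
    rw [hy] at this
    linarith
  have hφd : ∀ᶠ x in 𝓝 a, DifferentiableAt ℝ φ x :=
    (hφ.eventually (by simp)).mono fun x hx => hx.differentiableAt one_ne_zero
  have hGd : ∀ᶠ x in 𝓝 a, DifferentiableAt ℝ G x :=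
    (hGc.eventually (by simp)).mono fun x hx => hx.differentiableAt one_ne_zero
  have hgood : ∀ᶠ y in 𝓝 a, DifferentiableAt ℝ (f ∘ G) y ∧
      ∀ X, L X = 0 → fderiv ℝ (f ∘ G) y X = 0 := by
    filter_upwards [hφG.eventually_nhds, hGt.eventually hφd, hGd, hGt.eventually hf]
      with y h1 h2 h3 ⟨h4, h5⟩
    refine ⟨h4.comp y h3, fun X hX => ?_⟩
    rw [fderiv_comp y h4 h3]
    refine h5 _ ?_
    have h6 : HasFDerivAt (φ ∘ G) ((fderiv ℝ φ (G y)).comp (fderiv ℝ G y)) y :=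
      h2.hasFDerivAt.comp y h3.hasFDerivAt
    have h7 : HasFDerivAt (φ ∘ G) L y := by
      have : HasFDerivAt (fun y => φ a + L (y - a)) L y :=
        ((L.hasFDerivAt.comp y ((hasFDerivAt_id y).sub_const a)).const_add (φ a)).congr_fderiv
          (by ext; simp)
      exact this.congr_of_eventuallyEq h1
    have h8 := DFunLike.congr_fun (h6.unique h7) X
    simpa [hX] using h8
  obtain ⟨ε, hε, hball⟩ := Metric.eventually_nhds_iff_ball.1 hgood
  filter_upwards [hleft, hΨt.eventually (Metric.ball_mem_nhds a hε)] with x hx hxb hφx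
  have hker : L (Ψ x - a) = 0 := by rw [hLΨ, hφx, sub_self]
  have hseg : ∀ s ∈ Set.Icc (0 : ℝ) 1,
      HasDerivAt (fun s : ℝ => (f ∘ G) (a + s • (Ψ x - a))) 0 s := by
    intro s hs
    have hmem : a + s • (Ψ x - a) ∈ Metric.ball a ε :=
      (convex_ball a ε).add_smul_sub_mem (Metric.mem_ball_self hε) hxb hs
    obtain ⟨h1, h2⟩ := hball _ hmem
    have h3 : HasDerivAt (fun s : ℝ => a + s • (Ψ x - a)) (Ψ x - a) s := by
      simpa using ((hasDerivAt_id s).smul_const (Ψ x - a)).const_add a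
    have h4 := h1.hasFDerivAt.comp_hasDerivAt s h3
    rwa [h2 _ hker] at h4
  have := constant_of_derivWithin_zero
    (fun s hs => (hseg s hs).differentiableAt.differentiableWithinAt)
    (fun s hs => (hseg s (Set.Ico_subset_Icc_self hs)).hasDerivWithinAt.derivWithin
      (uniqueDiffOn_Icc zero_lt_one s (Set.Ico_subset_Icc_self hs))) 1 (by simp)
  simpa [hx, hGa] using this

theorem eqOn_connectedComponentIn_of_fderiv_eq_zero_on_ker {Ω : Set E} (hΩ : IsOpen Ω)
    {φ : E → ℝ} {f : E → F} (hφ : ∀ x ∈ Ω, ContDiffAt ℝ 1 φ x)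
    (hφ' : ∀ x ∈ Ω, fderiv ℝ φ x ≠ 0) (hf : ∀ x ∈ Ω, DifferentiableAt ℝ f x)
    (hf' : ∀ x ∈ Ω, ∀ X, fderiv ℝ φ x X = 0 → fderiv ℝ f x X = 0) {t : ℝ} {x₀ x : E}
    (hx₀ : x₀ ∈ Ω) (ht : φ x₀ = t)
    (hx : x ∈ connectedComponentIn {y ∈ Ω | φ y = t} x₀) : f x = f x₀ := by
  refine isPreconnected_connectedComponentIn.induction₂ (fun x y => f x = f y) ?_
    (fun x y z _ _ _ => Eq.trans) (fun x y _ _ => Eq.symm) hx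
    (mem_connectedComponentIn ⟨hx₀, ht⟩)
  intro y hy
  have hyS := connectedComponentIn_subset _ _ hy
  have := eventually_eq_of_fderiv_eq_zero_on_ker (hφ y hyS.1) (hφ' y hyS.1)
    ((hΩ.eventually_mem hyS.1).mono fun z hz => ⟨hf z hz, hf' z hz⟩)
  filter_upwards [nhdsWithin_le_nhds this, self_mem_nhdsWithin] with z hz hzS
  exact (hz ((connectedComponentIn_subset _ _ hzS).2.trans hyS.2.symm)).symm

end LevelSets

section Umbilical

variable {E : Type*} [NormedAddCommGroup E] [InnerProductSpace ℝ E]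

theorem exists_ne_zero_orthogonal_pair [FiniteDimensional ℝ E] (hE : 3 ≤ Module.finrank ℝ E)
    (u v : E) : ∃ y : E, y ≠ 0 ∧ ⟪u, y⟫ = 0 ∧ ⟪v, y⟫ = 0 := by
  classical
  have h1 := Submodule.finrank_add_finrank_orthogonal (Submodule.span ℝ {u, v})
  have h2 : Module.finrank ℝ (Submodule.span ℝ {u, v}) ≤ 2 := by
    have := finrank_span_finset_le_card (R := ℝ) ({u, v} : Finset E)
    simp only [Finset.coe_insert, Finset.coe_singleton] at this
    exact this.trans Finset.card_le_two
  have h3 : (Submodule.span ℝ {u, v})ᗮ ≠ ⊥ := by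
    intro h
    rw [h, finrank_bot] at h1
    omega
  obtain ⟨y, hy, hy0⟩ := Submodule.exists_mem_ne_zero_of_ne_bot h3
  rw [Submodule.mem_orthogonal] at hy
  exact ⟨y, hy0, hy u (Submodule.subset_span (by simp)), hy v (Submodule.subset_span (by simp))⟩

/-- The Codazzi equation for a unit normal field `ν` with totally umbilical level sets: the
principal curvature `κ` is constant in tangential directions. -/
theorem fderiv_principal_curvature_eq_zero [FiniteDimensional ℝ E]
    (hE : 3 ≤ Module.finrank ℝ E) {ν : E → E} {κ : E → ℝ} {x : E}
    (hν : ContDiffAt ℝ 2 ν x) (hκ : DifferentiableAt ℝ κ x) (hunit : ∀ᶠ y in 𝓝 x, ‖ν y‖ = 1)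
    (humb : ∀ᶠ y in 𝓝 x, ∀ X, ⟪ν y, X⟫ = 0 → fderiv ℝ ν y X = κ y • X)
    {X : E} (hX : ⟪ν x, X⟫ = 0) : fderiv ℝ κ x X = 0 := by
  have hνd : HasFDerivAt ν (fderiv ℝ ν x) x := (hν.differentiableAt two_ne_zero).hasFDerivAt
  have hνdd : HasFDerivAt (fderiv ℝ ν) (fderiv ℝ (fderiv ℝ ν) x) x :=
    ((hν.fderiv_right (m := 1) (by norm_num)).differentiableAt one_ne_zero).hasFDerivAt
  have hsymm : IsSymmSndFDerivAt ℝ ν x := hν.isSymmSndFDerivAt (by simp)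
  have key : ∀ X Y : E, ⟪ν x, X⟫ = 0 → ⟪ν x, Y⟫ = 0 →
      fderiv ℝ (fderiv ℝ ν) x Y X = fderiv ℝ κ x Y • X
        + (κ x * ⟪Y, X⟫) • (fderiv ℝ ν x (ν x) - κ x • ν x) := by
    intro X Y hX hY
    have hDY : fderiv ℝ ν x Y = κ x • Y := humb.self_of_nhds Y hY
    have hproj : HasFDerivAt (fun y => X - ⟪ν y, X⟫ • ν y) _ x :=
      (hasFDerivAt_const X x).sub ((hνd.inner ℝ (hasFDerivAt_const X x)).smul hνd)
    have h1 := hνdd.clm_apply hproj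
    have h2 := hκ.hasFDerivAt.smul hproj
    have heq : (fun y => fderiv ℝ ν y (X - ⟪ν y, X⟫ • ν y)) =ᶠ[𝓝 x]
        fun y => κ y • (X - ⟪ν y, X⟫ • ν y) := by
      filter_upwards [humb, hunit] with y hy hy1
      refine hy _ ?_
      rw [inner_sub_right, inner_smul_right, real_inner_self_eq_norm_sq, hy1]
      ring
    have h3 := DFunLike.congr_fun ((h1.congr_of_eventuallyEq heq.symm).unique h2) Y
    simp [hX, hDY, inner_smul_left] at h3
    rw [neg_add_eq_iff_eq_add] at h3
    rw [h3]
    module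
  obtain ⟨Y, hY0, hνY, hXY⟩ := exists_ne_zero_orthogonal_pair hE (ν x) X
  have h := hsymm X Y
  rw [key X Y hX hνY, key Y X hνY hX, real_inner_comm X Y, add_left_inj] at h
  have h' := congrArg (fun z => ⟪z, Y⟫) h
  simp only [inner_smul_left, hXY, mul_zero, RCLike.conj_to_real] at h'
  exact (mul_eq_zero.1 h').resolve_right (inner_self_ne_zero.2 hY0)

theorem fderiv_normalize_eq_smul {g : E → E} {x X : E} {c : ℝ} (hg : DifferentiableAt ℝ g x)
    (hgx : g x ≠ 0) (hX : ⟪g x, X⟫ = 0)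
    (h : ∀ Y, ⟪g x, Y⟫ = 0 → ⟪fderiv ℝ g x X, Y⟫ = c * ⟪X, Y⟫) :
    fderiv ℝ (fun y => ‖g y‖⁻¹ • g y) x X = (c / ‖g x‖) • X := by
  have hn : DifferentiableAt ℝ (fun y => ‖g y‖⁻¹) x := (hg.norm ℝ hgx).inv (norm_ne_zero_iff.2 hgx)
  have hN : DifferentiableAt ℝ (fun y => ‖g y‖⁻¹ • g y) x := hn.smul hg
  have hd : fderiv ℝ (fun y => ‖g y‖⁻¹ • g y) x X
      = ‖g x‖⁻¹ • fderiv ℝ g x X + fderiv ℝ (fun y => ‖g y‖⁻¹) x X • g x := by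
    have := DFunLike.congr_fun (fderiv_fun_smul hn hg) X
    simpa using this
  have horth : ⟪g x, fderiv ℝ (fun y => ‖g y‖⁻¹ • g y) x X⟫ = 0 := by
    have h1 := hN.hasFDerivAt.inner ℝ hN.hasFDerivAt
    have h2 : (fun y => ⟪‖g y‖⁻¹ • g y, ‖g y‖⁻¹ • g y⟫) =ᶠ[𝓝 x] fun _ => (1 : ℝ) := by
      filter_upwards [hg.continuousAt.eventually_ne hgx] with y hy
      have : ‖g y‖ ≠ 0 := norm_ne_zero_iff.2 hy
      rw [inner_smul_left, inner_smul_right, real_inner_self_eq_norm_sq, RCLike.conj_to_real]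
      field_simp
    have h3 := DFunLike.congr_fun
      ((h1.congr_of_eventuallyEq h2.symm).unique (hasFDerivAt_const (1 : ℝ) x)) X
    simp only [ContinuousLinearMap.comp_apply, ContinuousLinearMap.prod_apply,
      fderivInnerCLM_apply, zero_apply] at h3
    rw [real_inner_comm (‖g x‖⁻¹ • g x), ← two_mul, inner_smul_left, RCLike.conj_to_real] at h3
    have : ‖g x‖⁻¹ ≠ 0 := inv_ne_zero (norm_ne_zero_iff.2 hgx)
    simpa [this] using h3
  set Z := fderiv ℝ (fun y => ‖g y‖⁻¹ • g y) x X - (c / ‖g x‖) • X with hZ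
  have hgZ : ⟪g x, Z⟫ = 0 := by
    rw [hZ, inner_sub_right, horth, inner_smul_right, hX, mul_zero, sub_zero]
  have hZZ : ⟪Z, Z⟫ = 0 := by
    nth_rewrite 1 [hZ]
    rw [hd, inner_sub_left, inner_add_left, inner_smul_left, inner_smul_left, inner_smul_left,
      hgZ, h Z hgZ]
    simp only [RCLike.conj_to_real]
    ring
  exact sub_eq_zero.1 (inner_self_eq_zero.1 hZZ)

theorem bilin_eq_mul_inner_of_self {B : E →L[ℝ] E →L[ℝ] ℝ} (hB : ∀ X Y, B X Y = B Y X) {g : E}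
    {c : ℝ} (h : ∀ X, ⟪g, X⟫ = 0 → B X X = c * ‖X‖ ^ 2) {X Y : E} (hX : ⟪g, X⟫ = 0)
    (hY : ⟪g, Y⟫ = 0) : B X Y = c * ⟪X, Y⟫ := by
  have h1 := h (X + Y) (by rw [inner_add_right, hX, hY, add_zero])
  have h2 := h X hX
  have h3 := h Y hY
  rw [norm_add_sq_real] at h1
  simp only [map_add, add_apply] at h1
  rw [hB Y X] at h1
  linarith

theorem bilin_self_eq_of_norm_eq {B : E →L[ℝ] E →L[ℝ] ℝ} {g : E} {d : ℝ} (hg : g ≠ 0)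
    (h : ∀ X, ‖X‖ = ‖g‖ → ⟪X, g⟫ = 0 → B X X + d = 0) {X : E} (hX : ⟪g, X⟫ = 0) :
    B X X = -d / ‖g‖ ^ 2 * ‖X‖ ^ 2 := by
  rcases eq_or_ne X 0 with rfl | hX0
  · simp
  have hn : ‖X‖ ≠ 0 := norm_ne_zero_iff.2 hX0
  have hgn : ‖g‖ ≠ 0 := norm_ne_zero_iff.2 hg
  have h1 := h ((‖g‖ / ‖X‖) • X) (by rw [norm_smul, norm_div, norm_norm, norm_norm]; field_simp)
    (by rw [inner_smul_left, real_inner_comm, hX, mul_zero])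
  simp only [map_smul, smul_apply, smul_eq_mul] at h1
  field_simp at h1 ⊢
  linarith

/-- If the level sets of `φ` are totally umbilical with unit normal field `ν`, then each of their
connected components lies in a hyperplane or in a sphere. -/
theorem connectedComponentIn_subset_hyperplane_or_sphere [FiniteDimensional ℝ E]
    (hE : 3 ≤ Module.finrank ℝ E) {Ω : Set E} (hΩ : IsOpen Ω) {φ : E → ℝ} {ν : E → E} {κ : E → ℝ}
    (hφ : ∀ x ∈ Ω, ContDiffAt ℝ 1 φ x) (hφ' : ∀ x ∈ Ω, fderiv ℝ φ x ≠ 0)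
    (hν : ∀ x ∈ Ω, ContDiffAt ℝ 2 ν x) (hκ : ∀ x ∈ Ω, DifferentiableAt ℝ κ x)
    (hunit : ∀ x ∈ Ω, ‖ν x‖ = 1) (hker : ∀ x ∈ Ω, ∀ X, fderiv ℝ φ x X = 0 → ⟪ν x, X⟫ = 0)
    (humb : ∀ x ∈ Ω, ∀ X, ⟪ν x, X⟫ = 0 → fderiv ℝ ν x X = κ x • X)
    {t : ℝ} {x₀ : E} (hx₀ : x₀ ∈ Ω) (ht : φ x₀ = t) :
    (∃ (ξ : E) (c : ℝ), ξ ≠ 0 ∧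
        ∀ x ∈ connectedComponentIn {y ∈ Ω | φ y = t} x₀, ⟪ξ, x⟫ = c) ∨
      (∃ (α : E) (r : ℝ), 0 < r ∧
        ∀ x ∈ connectedComponentIn {y ∈ Ω | φ y = t} x₀, ‖x - α‖ = r) := by
  have hdκ : ∀ x ∈ Ω, ∀ X, fderiv ℝ φ x X = 0 → fderiv ℝ κ x X = 0 := fun x hx X hX =>
    fderiv_principal_curvature_eq_zero hE (hν x hx) (hκ x hx)
      ((hΩ.eventually_mem hx).mono hunit) ((hΩ.eventually_mem hx).mono humb) (hker x hx X hX)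
  have hνd : ∀ x ∈ Ω, HasFDerivAt ν (fderiv ℝ ν x) x := fun x hx =>
    ((hν x hx).differentiableAt two_ne_zero).hasFDerivAt
  have hκc : ∀ x ∈ connectedComponentIn {y ∈ Ω | φ y = t} x₀, κ x = κ x₀ := fun x hx =>
    eqOn_connectedComponentIn_of_fderiv_eq_zero_on_ker hΩ hφ hφ' hκ hdκ hx₀ ht hx
  have hcenter : ∀ x ∈ connectedComponentIn {y ∈ Ω | φ y = t} x₀,
      ν x - κ x • x = ν x₀ - κ x₀ • x₀ := by
    intro x hx
    have hder := fun x hx => (hνd x hx).sub ((hκ x hx).hasFDerivAt.smul (hasFDerivAt_id x))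
    refine eqOn_connectedComponentIn_of_fderiv_eq_zero_on_ker (f := fun x => ν x - κ x • x)
      hΩ hφ hφ' (fun x hx => (hder x hx).differentiableAt) (fun x hx X hX => ?_) hx₀ ht hx
    refine (DFunLike.congr_fun (hder x hx).fderiv X).trans ?_
    simp [hdκ x hx X hX, humb x hx X (hker x hx X hX)]
  have hheight : ∀ x ∈ connectedComponentIn {y ∈ Ω | φ y = t} x₀,
      ⟪ν x, x⟫ - κ x * (⟪x, x⟫ / 2) = ⟪ν x₀, x₀⟫ - κ x₀ * (⟪x₀, x₀⟫ / 2) := by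
    intro x hx
    have hder := fun x hx => ((hνd x hx).inner ℝ (hasFDerivAt_id x)).sub
      ((hκ x hx).hasFDerivAt.mul
        (((hasFDerivAt_id x).inner ℝ (hasFDerivAt_id x)).mul_const (2⁻¹ : ℝ)))
    simp only [← div_eq_mul_inv] at hder
    refine eqOn_connectedComponentIn_of_fderiv_eq_zero_on_ker
      (f := fun x => ⟪ν x, x⟫ - κ x * (⟪x, x⟫ / 2))
      hΩ hφ hφ' (fun x hx => (hder x hx).differentiableAt) (fun x hx X hX => ?_) hx₀ ht hx
    refine (DFunLike.congr_fun (hder x hx).fderiv X).trans ?_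
    simp [hdκ x hx X hX, humb x hx X (hker x hx X hX), hker x hx X hX, inner_smul_left,
      real_inner_comm x X]
    ring
  have hsub := connectedComponentIn_subset {y ∈ Ω | φ y = t} x₀
  by_cases h0 : κ x₀ = 0
  · refine Or.inl ⟨ν x₀, ⟪ν x₀, x₀⟫, ?_, fun x hx => ?_⟩
    · exact norm_ne_zero_iff.1 (by rw [hunit x₀ hx₀]; exact one_ne_zero)
    · have h1 := hcenter x hx
      have h2 := hheight x hx
      rw [hκc x hx, h0] at h1 h2
      simp only [zero_smul, sub_zero, zero_mul] at h1 h2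
      rw [← h1, h2, h1]
  · refine Or.inr ⟨x₀ - (κ x₀)⁻¹ • ν x₀, |κ x₀|⁻¹, by positivity, fun x hx => ?_⟩
    have h1 := hcenter x hx
    rw [hκc x hx] at h1
    have h2 : x - (x₀ - (κ x₀)⁻¹ • ν x₀) = (κ x₀)⁻¹ • ν x := by
      have h3 : ν x = κ x₀ • (x - x₀) + ν x₀ := by
        rw [smul_sub, sub_eq_iff_eq_add.1 h1]
        abel
      rw [h3, smul_add, inv_smul_smul₀ h0]
      abel
    rw [h2, norm_smul, hunit x (hsub hx).1, mul_one, norm_inv, Real.norm_eq_abs]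

end Umbilical

theorem statement11 {n : ℕ} (hn : 3 ≤ n) (Ω : Set (EuclideanSpace ℝ (Fin n)))
    (hΩ : IsOpen Ω)
    (φ : EuclideanSpace ℝ (Fin n) → ℝ) (hφ : ContDiffOn ℝ (⊤ : ℕ∞) φ Ω)
    (hlcw : IsLCW Ω φ) :
    ∀ t : ℝ, ∀ x₀ ∈ Ω, φ x₀ = t →
      (∃ (ξ : EuclideanSpace ℝ (Fin n)) (c : ℝ), ξ ≠ 0 ∧
          ∀ x ∈ connectedComponentIn {y ∈ Ω | φ y = t} x₀, ⟪ξ, x⟫ = c) ∨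
      (∃ (α : EuclideanSpace ℝ (Fin n)) (r : ℝ), 0 < r ∧
          ∀ x ∈ connectedComponentIn {y ∈ Ω | φ y = t} x₀, ‖x - α‖ = r) := by
  intro t x₀ hx₀ ht
  have hc : ∀ x ∈ Ω, ContDiffAt ℝ 3 φ x := fun x hx =>
    (hφ.contDiffAt (hΩ.mem_nhds hx)).of_le (WithTop.coe_le_coe.2 le_top)
  have hg2 : ∀ x ∈ Ω, ContDiffAt ℝ 2 (gradient φ) x := fun x hx =>
    (InnerProductSpace.toDual ℝ _).symm.contDiff.contDiffAt.comp x
      ((hc x hx).fderiv_right (by norm_num))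
  have hB : ∀ x ∈ Ω, ContDiffAt ℝ 1 (fderiv ℝ (fderiv ℝ φ)) x := fun x hx =>
    ((hc x hx).fderiv_right (m := 2) (by norm_num)).fderiv_right (by norm_num)
  have hn2 : ∀ x ∈ Ω, ContDiffAt ℝ 2 (fun y => ‖gradient φ y‖) x := fun x hx =>
    (hg2 x hx).norm ℝ (hlcw.1 x hx)
  have hn0 : ∀ x ∈ Ω, ‖gradient φ x‖ ≠ 0 := fun x hx => norm_ne_zero_iff.2 (hlcw.1 x hx)
  have hgd : ∀ x ∈ Ω, DifferentiableAt ℝ (gradient φ) x := fun x hx =>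
    (hg2 x hx).differentiableAt two_ne_zero
  refine connectedComponentIn_subset_hyperplane_or_sphere (by simpa using hn) hΩ
    (ν := fun x => ‖gradient φ x‖⁻¹ • gradient φ x)
    (κ := fun x => -fderiv ℝ (fderiv ℝ φ) x (gradient φ x) (gradient φ x) / ‖gradient φ x‖ ^ 2
      / ‖gradient φ x‖)
    (fun x hx => (hc x hx).of_le (by norm_num)) (fun x hx h => hlcw.1 x hx ?_)
    (fun x hx => ((hn2 x hx).inv (hn0 x hx)).smul (hg2 x hx)) (fun x hx => ?_) (fun x hx => ?_)
    (fun x hx X hX => ?_) (fun x hx X hX => ?_) hx₀ ht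
  · simp [gradient, h]
  · have hnd := (hn2 x hx).differentiableAt two_ne_zero
    have hBd := (((hB x hx).differentiableAt one_ne_zero).clm_apply (hgd x hx)).clm_apply (hgd x hx)
    simp only [div_eq_mul_inv]
    exact (hBd.fun_neg.fun_mul ((hnd.fun_pow 2).fun_inv (pow_ne_zero 2 (hn0 x hx)))).fun_mul
      (hnd.fun_inv (hn0 x hx))
  · rw [norm_smul, norm_inv, norm_norm, inv_mul_cancel₀ (hn0 x hx)]
  · rw [inner_smul_left, inner_gradient_left, hX, mul_zero]
  · have hX' : ⟪gradient φ x, X⟫ = 0 := by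
      simpa [inner_smul_left, hlcw.1 x hx] using hX
    have hsymm : IsSymmSndFDerivAt ℝ φ x :=
      (hc x hx).isSymmSndFDerivAt (by norm_num)
    refine fderiv_normalize_eq_smul (hgd x hx) (hlcw.1 x hx) hX' fun Y hY => ?_
    have hd : fderiv ℝ (gradient φ) x X
        = (InnerProductSpace.toDual ℝ _).symm (fderiv ℝ (fderiv ℝ φ) x X) := by
      have h1 := ((hc x hx).fderiv_right (m := 1) (by norm_num)).differentiableAt
        one_ne_zero
      have h2 := (InnerProductSpace.toDual ℝ (EuclideanSpace ℝ (Fin n))).symm.toContinuousLinearEquiv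
        |>.hasFDerivAt.comp x h1.hasFDerivAt
      exact DFunLike.congr_fun h2.fderiv X
    rw [hd, InnerProductSpace.toDual_symm_apply]
    refine bilin_eq_mul_inner_of_self hsymm (fun Z hZ => ?_) hX' hY
    refine bilin_self_eq_of_norm_eq (hlcw.1 x hx) (fun W hW hWg => ?_) hZ
    have := hlcw.2 x hx W hW hWg
    simpa [Hess, iteratedFDeriv_two_apply] using this
end
end

section
/- Let J ⊆ ℝ be an open interval, let K > 0, and let μ : J → ℝ be smooth (at least C³) with μ̇(t)² − μ(t)·μ̈(t) = K for all t ∈ J. Then there exists a constant c ∈ ℝ such that μ̈(t) = c·μ(t) for all t ∈ J. -/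
noncomputable section

/-- The zeros of a function on a set where it has nonzero derivative at each zero are countable. -/
theorem countable_zeros_of_hasDerivAt_ne_zero {J : Set ℝ} {f g : ℝ → ℝ}
    (hf : ∀ t ∈ J, HasDerivAt f (g t) t) (hg : ∀ t ∈ J, f t = 0 → g t ≠ 0) :
    {t | t ∈ J ∧ f t = 0}.Countable := by
  have hdisc : DiscreteTopology {t | t ∈ J ∧ f t = 0} := by
    rw [discreteTopology_subtype_iff]
    rintro x ⟨hxJ, hx⟩
    have hne := (hf x hxJ).eventually_ne (c := 0) (hg x hxJ hx)
    rw [← disjoint_iff, Filter.disjoint_principal_right]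
    filter_upwards [hne] with z hz hmem using hz hmem.2
  exact Set.countable_coe_iff.mp countable_of_Lindelof_of_discrete

/-- If `f` and `h` satisfy `f' h = f h'` and `f` has only simple zeros, then the quotient `h / f`
extends continuously across the zeros of `f`, and is constant. -/
theorem exists_eq_const_mul_of_wronskian_eq_zero {J : Set ℝ} (hJ : IsOpen J)
    (hJc : J.OrdConnected) {f g h k : ℝ → ℝ} (hf : ∀ t ∈ J, HasDerivAt f (g t) t)
    (hh : ∀ t ∈ J, HasDerivAt h (k t) t) (hgc : ContinuousOn g J) (hkc : ContinuousOn k J)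
    (hw : ∀ t ∈ J, g t * h t = f t * k t) (hg : ∀ t ∈ J, f t = 0 → g t ≠ 0) :
    ∃ c : ℝ, ∀ t ∈ J, h t = c * f t := by
  classical
  rcases J.eq_empty_or_nonempty with rfl | ⟨a, ha⟩
  · exact ⟨0, by simp⟩
  set σ : ℝ → ℝ := fun t => if f t = 0 then k t / g t else h t / f t with hσ
  have hσ_off : ∀ t ∈ J, f t ≠ 0 → σ =ᶠ[nhds t] fun s => h s / f s := fun t ht h0 => by
    filter_upwards [(hf t ht).continuousAt.eventually_ne h0] with s hs
    simp [hσ, hs]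
  have hσ_cont : ContinuousOn σ J := by
    intro t ht
    refine ContinuousAt.continuousWithinAt ?_
    by_cases h0 : f t = 0
    · have hgt := hgc.continuousAt (hJ.mem_nhds ht)
      have heq : σ =ᶠ[nhds t] fun s => k s / g s := by
        filter_upwards [hgt.eventually_ne (hg t ht h0), hJ.mem_nhds ht] with s hs hsJ
        by_cases h1 : f s = 0
        · simp [hσ, h1]
        · simp only [hσ, h1, if_false]
          rw [div_eq_div_iff h1 hs]
          linarith [hw s hsJ]
      exact ((hkc.continuousAt (hJ.mem_nhds ht)).div hgt (hg t ht h0)).congr heq.symm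
    · exact ((hh t ht).continuousAt.div (hf t ht).continuousAt h0).congr (hσ_off t ht h0).symm
  have hσ_deriv : ∀ t ∈ J, f t ≠ 0 → HasDerivAt σ 0 t := fun t ht h0 => by
    have hd := ((hh t ht).div (hf t ht) h0).congr_of_eventuallyEq (hσ_off t ht h0)
    rwa [show k t * f t - h t * g t = 0 by linarith [hw t ht], zero_div] at hd
  have hcount := countable_zeros_of_hasDerivAt_ne_zero hf hg
  have hσ_const : ∀ x ∈ J, ∀ y ∈ J, x ≤ y → σ x = σ y := by
    intro x hx y hy hxy
    have hsub : Set.Icc x y ⊆ J := hJc.out hx hy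
    have hint := MeasureTheory.integral_eq_of_hasDerivAt_off_countable_of_le σ (fun _ => 0) hxy
      hcount (hσ_cont.mono hsub)
      (fun t ht => by
        have htJ := hsub (Set.Ioo_subset_Icc_self ht.1)
        exact hσ_deriv t htJ fun h0 => ht.2 ⟨htJ, h0⟩)
      (by simp)
    simp only [intervalIntegral.integral_zero] at hint
    linarith
  refine ⟨σ a, fun t ht => ?_⟩
  have hta : σ a = σ t := by
    rcases le_total a t with hle | hle
    · exact hσ_const a ha t ht hle
    · exact (hσ_const t ht a ha hle).symm
  rw [hta]
  by_cases h0 : f t = 0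
  · have hgh := hw t ht
    rw [h0, zero_mul] at hgh
    rw [h0, mul_zero]
    exact (mul_eq_zero.mp hgh).resolve_left (hg t ht h0)
  · simp [hσ, h0]

theorem statement12 (J : Set ℝ) (hJopen : IsOpen J) (hJint : J.OrdConnected)
    (K : ℝ) (hK : 0 < K) (μ : ℝ → ℝ) (hμ : ContDiffOn ℝ 3 μ J)
    (hode : ∀ t ∈ J, (deriv μ t) ^ 2 - μ t * deriv (deriv μ) t = K) :
    ∃ c : ℝ, ∀ t ∈ J, deriv (deriv μ) t = c * μ t := by
  have h1 : ContDiffOn ℝ 2 (deriv μ) J := hμ.deriv_of_isOpen hJopen (by norm_num)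
  have h2 : ContDiffOn ℝ 1 (deriv (deriv μ)) J := h1.deriv_of_isOpen hJopen (by norm_num)
  have h3 : ContDiffOn ℝ 0 (deriv (deriv (deriv μ))) J :=
    h2.deriv_of_isOpen hJopen (by norm_num)
  have hasDeriv : ∀ {n : WithTop ℕ∞} {u : ℝ → ℝ}, ContDiffOn ℝ n u J → n ≠ 0 →
      ∀ t ∈ J, HasDerivAt u (deriv u t) t := fun hu hn t ht =>
    ((hu.differentiableOn hn).differentiableAt (hJopen.mem_nhds ht)).hasDerivAt
  have d0 := hasDeriv hμ (by norm_num)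
  have d1 := hasDeriv h1 (by norm_num)
  have d2 := hasDeriv h2 (by norm_num)
  refine exists_eq_const_mul_of_wronskian_eq_zero hJopen hJint d0 d2 h1.continuousOn
    h3.continuousOn (fun t ht => ?_) (fun t ht h0 hg => ?_)
  · have hd := ((d1 t ht).pow 2).sub ((d0 t ht).mul (d2 t ht))
    have hconst := (hasDerivAt_const t K).congr_of_eventuallyEq
      (Filter.eventually_of_mem (hJopen.mem_nhds ht) hode)
    have huniq := hd.unique hconst
    norm_num at huniq
    linarith
  · have ht := hode t ht
    rw [h0, hg] at ht
    norm_num at ht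
    linarith
end
end

section
/- Let J ⊆ ℝ be an open interval, let K > 0, and let μ : J → ℝ be smooth with μ̇(t)² − μ(t)·μ̈(t) = K for all t ∈ J. Then one of the following holds: (i) there exist ε ∈ {1, −1} and b ∈ ℝ with μ(t) = ε·√K·(t + b) for all t ∈ J; (ii) there exist a > 0 and b ∈ ℝ with μ(t) = (√K / a)·sin(a t + b) for all t ∈ J; (iii) there exist ε ∈ {1, −1}, a > 0 and b ∈ ℝ with μ(t) = ε·(√K / a)·sinh(a t + b) for all t ∈ J. -/
theorem contDiffOn_iterate_deriv {J : Set ℝ} (hJ : IsOpen J) {f : ℝ → ℝ}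
    (hf : ContDiffOn ℝ (⊤ : ℕ∞) f J) (n : ℕ) : ContDiffOn ℝ (⊤ : ℕ∞) (deriv^[n] f) J := by
  induction n with
  | zero => exact hf
  | succ n ih =>
    rw [Function.iterate_succ_apply']
    exact ih.deriv_of_isOpen hJ (by simp)

theorem hasDerivAt_iterate_deriv {J : Set ℝ} (hJ : IsOpen J) {f : ℝ → ℝ}
    (hf : ContDiffOn ℝ (⊤ : ℕ∞) f J) (n : ℕ) {t : ℝ} (ht : t ∈ J) :
    HasDerivAt (deriv^[n] f) (deriv^[n + 1] f t) t := by
  rw [Function.iterate_succ_apply']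
  exact (((contDiffOn_iterate_deriv hJ hf n).differentiableOn (by simp)).differentiableAt
    (hJ.mem_nhds ht)).hasDerivAt

theorem HasDerivAt.eq_of_eqOn_isOpen {J : Set ℝ} (hJ : IsOpen J) {f g : ℝ → ℝ} {f' g' t : ℝ}
    (hfg : ∀ s ∈ J, f s = g s) (ht : t ∈ J) (hf : HasDerivAt f f' t) (hg : HasDerivAt g g' t) :
    f' = g' :=
  hf.unique (hg.congr_of_eventuallyEq (Filter.eventually_of_mem (hJ.mem_nhds ht) hfg))

theorem exists_eq_const_of_hasDerivAt_zero {J : Set ℝ} (hJ : IsOpen J) (hJint : J.OrdConnected)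
    {f : ℝ → ℝ} (hf : ∀ t ∈ J, HasDerivAt f 0 t) : ∃ c, ∀ t ∈ J, f t = c :=
  hJ.exists_is_const_of_deriv_eq_zero hJint.isPreconnected
    (fun t ht => (hf t ht).differentiableAt.differentiableWithinAt) fun t ht => (hf t ht).deriv

/-- If `μ' ^ 2 - μ * μ''` is a nonzero constant, then `μ'' = c * μ` for a constant `c`. -/
theorem exists_deriv_deriv_eq_const_mul {J : Set ℝ} (hJ : IsOpen J) (hJint : J.OrdConnected)
    {K : ℝ} (hK : K ≠ 0) {μ : ℝ → ℝ} (hμ : ContDiffOn ℝ (⊤ : ℕ∞) μ J)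
    (hode : ∀ t ∈ J, (deriv μ t) ^ 2 - μ t * deriv (deriv μ) t = K) :
    ∃ c, ∀ t ∈ J, deriv (deriv μ) t = c * μ t := by
  obtain ⟨m3, m4, m5, h0, h1, h2, h3, h4⟩ : ∃ m3 m4 m5 : ℝ → ℝ,
      (∀ t ∈ J, HasDerivAt μ (deriv μ t) t) ∧
      (∀ t ∈ J, HasDerivAt (deriv μ) (deriv (deriv μ) t) t) ∧
      (∀ t ∈ J, HasDerivAt (deriv (deriv μ)) (m3 t) t) ∧
      (∀ t ∈ J, HasDerivAt m3 (m4 t) t) ∧ ∀ t ∈ J, HasDerivAt m4 (m5 t) t :=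
    have hd := fun (n : ℕ) (t : ℝ) (ht : t ∈ J) => hasDerivAt_iterate_deriv hJ hμ n ht
    ⟨deriv^[3] μ, deriv^[4] μ, deriv^[5] μ, hd 0, hd 1, hd 2, hd 3, hd 4⟩
  generalize deriv (deriv μ) = m2 at *
  generalize deriv μ = m1 at *
  have e3 : ∀ t ∈ J, μ t * m3 t = m1 t * m2 t := fun t ht => by
    have := HasDerivAt.eq_of_eqOn_isOpen hJ hode ht
      (((h1 t ht).pow 2).sub ((h0 t ht).mul (h2 t ht))) (hasDerivAt_const t K)
    norm_num at this
    linarith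
  have e4 : ∀ t ∈ J, μ t * m4 t = m2 t * m2 t := fun t ht => by
    have := HasDerivAt.eq_of_eqOn_isOpen hJ e3 ht
      ((h0 t ht).mul (h3 t ht)) ((h1 t ht).mul (h2 t ht))
    linarith
  have e5 : ∀ t ∈ J, m1 t * m4 t + μ t * m5 t = m3 t * m2 t + m2 t * m3 t := fun t ht =>
    HasDerivAt.eq_of_eqOn_isOpen hJ e4 ht
      ((h0 t ht).mul (h4 t ht)) ((h2 t ht).mul (h2 t ht))
  have hV : ∀ t ∈ J, HasDerivAt (fun s => m3 s * m1 s - m2 s * m2 s) 0 t := fun t ht => by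
    refine HasDerivAt.congr_deriv (((h3 t ht).mul (h1 t ht)).sub ((h2 t ht).mul (h2 t ht))) ?_
    have i0 := hode t ht
    have i3 := e3 t ht
    have i4 := e4 t ht
    have i5 := e5 t ht
    by_cases hz : μ t = 0
    · rw [hz] at i0 i3 i5
      have hm1 : m1 t ≠ 0 := by
        intro h
        rw [h] at i0
        exact hK (by linarith)
      have hm2 : m2 t = 0 := by simpa [hm1] using i3.symm
      simp only [hm2] at i5 ⊢
      linarith
    · apply mul_left_cancel₀ hz
      linear_combination m1 t * i4 - m2 t * i3
  obtain ⟨c, hc⟩ := exists_eq_const_of_hasDerivAt_zero hJ hJint hV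
  refine ⟨c / K, fun t ht => ?_⟩
  field_simp
  linear_combination (-m2 t) * hode t ht - m1 t * e3 t ht + μ t * hc t ht

theorem exists_linear_of_deriv {J : Set ℝ} (hJ : IsOpen J) (hJint : J.OrdConnected)
    (hne : J.Nonempty) {K : ℝ} (hK : 0 < K) {μ ν : ℝ → ℝ}
    (hμ : ∀ t ∈ J, HasDerivAt μ (ν t) t) (hν : ∀ t ∈ J, HasDerivAt ν 0 t)
    (hode : ∀ t ∈ J, ν t ^ 2 = K) :
    ∃ ε : ℝ, (ε = 1 ∨ ε = -1) ∧ ∃ b : ℝ, ∀ t ∈ J, μ t = ε * Real.sqrt K * (t + b) := by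
  obtain ⟨s, hs⟩ := exists_eq_const_of_hasDerivAt_zero hJ hJint hν
  obtain ⟨d, hd⟩ := exists_eq_const_of_hasDerivAt_zero (f := fun t => μ t - s * t) hJ hJint
    fun t ht => by
      refine HasDerivAt.congr_deriv ((hμ t ht).sub ((hasDerivAt_id t).const_mul s)) ?_
      rw [hs t ht]
      ring
  obtain ⟨t₀, ht₀⟩ := hne
  have hsK : s ^ 2 = K := hs t₀ ht₀ ▸ hode t₀ ht₀
  have hs0 : s ≠ 0 := by
    rintro rfl
    norm_num at hsK
    exact hK.ne hsK
  have key : ∀ t ∈ J, μ t = s * (t + d / s) := fun t ht => by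
    have := hd t ht
    field_simp
    linarith
  rw [← hsK, Real.sqrt_sq_eq_abs]
  rcases abs_choice s with h | h
  · exact ⟨1, Or.inl rfl, d / s, fun t ht => by rw [key t ht, h]; ring⟩
  · exact ⟨-1, Or.inr rfl, d / s, fun t ht => by rw [key t ht, h]; ring⟩

theorem exists_sin_of_deriv {J : Set ℝ} (hJ : IsOpen J) (hJint : J.OrdConnected)
    (hne : J.Nonempty) {K a : ℝ} (ha : 0 < a) {μ ν : ℝ → ℝ}
    (hμ : ∀ t ∈ J, HasDerivAt μ (ν t) t) (hν : ∀ t ∈ J, HasDerivAt ν (-a ^ 2 * μ t) t)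
    (hode : ∀ t ∈ J, ν t ^ 2 + a ^ 2 * μ t ^ 2 = K) :
    ∃ b : ℝ, ∀ t ∈ J, μ t = (Real.sqrt K / a) * Real.sin (a * t + b) := by
  have hat : ∀ t, HasDerivAt (fun t => a * t) a t := fun t => by
    simpa using (hasDerivAt_id t).const_mul a
  obtain ⟨p, hp⟩ := exists_eq_const_of_hasDerivAt_zero hJ hJint
    (f := fun t => ν t * Real.cos (a * t) + a * μ t * Real.sin (a * t)) fun t ht => by
      refine HasDerivAt.congr_deriv (((hν t ht).mul (hat t).cos).add (((hμ t ht).const_mul a).mul (hat t).sin)) ?_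
      ring
  obtain ⟨q, hq⟩ := exists_eq_const_of_hasDerivAt_zero hJ hJint
    (f := fun t => a * μ t * Real.cos (a * t) - ν t * Real.sin (a * t)) fun t ht => by
      refine HasDerivAt.congr_deriv ((((hμ t ht).const_mul a).mul (hat t).cos).sub ((hν t ht).mul (hat t).sin)) ?_
      ring
  obtain ⟨t₀, ht₀⟩ := hne
  have hpq : p ^ 2 + q ^ 2 = K := by
    rw [← hp t₀ ht₀, ← hq t₀ ht₀, ← hode t₀ ht₀]
    linear_combination (ν t₀ ^ 2 + a ^ 2 * μ t₀ ^ 2) * Real.sin_sq_add_cos_sq (a * t₀)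
  have hnorm : ‖(⟨p, q⟩ : ℂ)‖ = Real.sqrt K := by
    rw [Complex.norm_eq_sqrt_sq_add_sq, hpq]
  refine ⟨Complex.arg ⟨p, q⟩, fun t ht => ?_⟩
  have hcos := Complex.norm_mul_cos_arg ⟨p, q⟩
  have hsin := Complex.norm_mul_sin_arg ⟨p, q⟩
  rw [hnorm] at hcos hsin
  rw [Real.sin_add]
  field_simp
  linear_combination (-Real.sin (a * t)) * hcos - Real.cos (a * t) * hsin
    + Real.sin (a * t) * hp t ht + Real.cos (a * t) * hq t ht
    - (a * μ t) * Real.sin_sq_add_cos_sq (a * t)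

theorem exists_sinh_of_deriv {J : Set ℝ} (hJ : IsOpen J) (hJint : J.OrdConnected)
    (hne : J.Nonempty) {K a : ℝ} (hK : 0 < K) (ha : 0 < a) {μ ν : ℝ → ℝ}
    (hμ : ∀ t ∈ J, HasDerivAt μ (ν t) t) (hν : ∀ t ∈ J, HasDerivAt ν (a ^ 2 * μ t) t)
    (hode : ∀ t ∈ J, ν t ^ 2 - a ^ 2 * μ t ^ 2 = K) :
    ∃ ε : ℝ, (ε = 1 ∨ ε = -1) ∧ ∃ b : ℝ, ∀ t ∈ J,
      μ t = ε * (Real.sqrt K / a) * Real.sinh (a * t + b) := by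
  have hat : ∀ t, HasDerivAt (fun t => a * t) a t := fun t => by
    simpa using (hasDerivAt_id t).const_mul a
  have hexp : ∀ t, Real.exp (a * t) * Real.exp (-(a * t)) = 1 := fun t => by
    rw [← Real.exp_add, add_neg_cancel, Real.exp_zero]
  obtain ⟨p, hp⟩ := exists_eq_const_of_hasDerivAt_zero hJ hJint
    (f := fun t => (ν t + a * μ t) * Real.exp (-(a * t))) fun t ht => by
      refine HasDerivAt.congr_deriv (((hν t ht).add ((hμ t ht).const_mul a)).mul (hat t).neg.exp) ?_
      simp only [Pi.add_apply, Pi.neg_apply]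
      ring
  obtain ⟨q, hq⟩ := exists_eq_const_of_hasDerivAt_zero hJ hJint
    (f := fun t => (ν t - a * μ t) * Real.exp (a * t)) fun t ht => by
      refine HasDerivAt.congr_deriv (((hν t ht).sub ((hμ t ht).const_mul a)).mul (hat t).exp) ?_
      simp only [Pi.sub_apply]
      ring
  obtain ⟨t₀, ht₀⟩ := hne
  have hpq : p * q = K := by
    rw [← hp t₀ ht₀, ← hq t₀ ht₀, ← hode t₀ ht₀]
    linear_combination (ν t₀ ^ 2 - a ^ 2 * μ t₀ ^ 2) * hexp t₀
  have hsol : ∀ t ∈ J, 2 * a * μ t = p * Real.exp (a * t) - q * Real.exp (-(a * t)) :=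
    fun t ht => by
      linear_combination Real.exp (a * t) * hp t ht - Real.exp (-(a * t)) * hq t ht
        - (2 * a * μ t) * hexp t
  have hp0 : p ≠ 0 := by
    rintro rfl
    linarith
  have hsq : Real.sqrt K * Real.sqrt K = K := Real.mul_self_sqrt hK.le
  have hsK : 0 < Real.sqrt K := Real.sqrt_pos.2 hK
  obtain ⟨ε, hε, hεp⟩ : ∃ ε : ℝ, (ε = 1 ∨ ε = -1) ∧ 0 < ε * p := by
    rcases hp0.lt_or_gt with h | h
    · exact ⟨-1, Or.inr rfl, by linarith⟩
    · exact ⟨1, Or.inl rfl, by linarith⟩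
  have hε2 : ε * ε = 1 := by rcases hε with rfl | rfl <;> norm_num
  refine ⟨ε, hε, Real.log (ε * p / Real.sqrt K), fun t ht => ?_⟩
  have hε0 : ε ≠ 0 := left_ne_zero_of_mul_eq_one hε2
  have hq' : q = K / p := by
    field_simp
    linarith
  have h := hsol t ht
  rw [Real.sinh_eq, neg_add, Real.exp_add, Real.exp_add, Real.exp_neg (Real.log _),
    Real.exp_log (div_pos hεp hsK)]
  rw [hq', ← hsq] at h
  have hμt : μ t = (p * Real.exp (a * t) -
      Real.sqrt K * Real.sqrt K / p * Real.exp (-(a * t))) / (2 * a) := by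
    rw [← h]
    field_simp
  rw [hμt]
  field_simp
  linear_combination (-(p ^ 2 * Real.exp (a * t))) * hε2

theorem statement13 (J : Set ℝ) (hJopen : IsOpen J) (hJint : J.OrdConnected)
    (K : ℝ) (hK : 0 < K) (μ : ℝ → ℝ) (hμ : ContDiffOn ℝ (⊤ : ℕ∞) μ J)
    (hode : ∀ t ∈ J, (deriv μ t) ^ 2 - μ t * deriv (deriv μ) t = K) :
    (∃ ε : ℝ, (ε = 1 ∨ ε = -1) ∧ ∃ b : ℝ, ∀ t ∈ J,
        μ t = ε * Real.sqrt K * (t + b)) ∨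
    (∃ a : ℝ, 0 < a ∧ ∃ b : ℝ, ∀ t ∈ J,
        μ t = (Real.sqrt K / a) * Real.sin (a * t + b)) ∨
    (∃ ε : ℝ, (ε = 1 ∨ ε = -1) ∧ ∃ a : ℝ, 0 < a ∧ ∃ b : ℝ, ∀ t ∈ J,
        μ t = ε * (Real.sqrt K / a) * Real.sinh (a * t + b)) := by
  rcases J.eq_empty_or_nonempty with rfl | hne
  · exact Or.inl ⟨1, Or.inl rfl, 0, by simp⟩
  obtain ⟨c, hc⟩ := exists_deriv_deriv_eq_const_mul hJopen hJint hK.ne' hμ hode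
  have h0 : ∀ t ∈ J, HasDerivAt μ (deriv μ t) t :=
    fun t ht => hasDerivAt_iterate_deriv hJopen hμ 0 ht
  have h1 : ∀ t ∈ J, HasDerivAt (deriv μ) (c * μ t) t :=
    fun t ht => hc t ht ▸ hasDerivAt_iterate_deriv hJopen hμ 1 ht
  have hfirst : ∀ t ∈ J, deriv μ t ^ 2 - c * μ t ^ 2 = K := fun t ht => by
    rw [← hode t ht, hc t ht]
    ring
  rcases lt_trichotomy c 0 with hneg | rfl | hpos
  · obtain ⟨a, ha, rfl⟩ : ∃ a : ℝ, 0 < a ∧ c = -a ^ 2 :=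
      ⟨Real.sqrt (-c), Real.sqrt_pos.2 (by linarith), by rw [Real.sq_sqrt (by linarith)]; ring⟩
    exact Or.inr (Or.inl ⟨a, ha, exists_sin_of_deriv hJopen hJint hne ha h0 h1
      fun t ht => by linarith [hfirst t ht]⟩)
  · exact Or.inl (exists_linear_of_deriv hJopen hJint hne hK h0
      (by simpa using h1) (by simpa using hfirst))
  · obtain ⟨a, ha, rfl⟩ : ∃ a : ℝ, 0 < a ∧ c = a ^ 2 :=
      ⟨Real.sqrt c, Real.sqrt_pos.2 hpos, (Real.sq_sqrt hpos.le).symm⟩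
    obtain ⟨ε, hε, b, hb⟩ := exists_sinh_of_deriv hJopen hJint hne hK ha h0 h1 hfirst
    exact Or.inr (Or.inr ⟨ε, hε, a, ha, b, hb⟩)
end

section
/- Let J ⊆ ℝ be an open interval, let μ : J → ℝ be smooth with μ(t)·μ̈(t) = μ̇(t)² for all t ∈ J, and suppose μ(t₀) ≠ 0 for some t₀ ∈ J. Then μ(t) ≠ 0 for all t ∈ J, and there exists a constant c ∈ ℝ with μ(t) = μ(t₀)·exp(c·(t − t₀)) for all t ∈ J. -/
noncomputable section

/-- On an open preconnected set where `f` has no zero, `f * f'' = f' ^ 2` makes the logarithmic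
derivative constant, so `f` is exponential. -/
theorem eq_exp_of_mul_deriv_deriv_eq_sq {U : Set ℝ} (hU : IsOpen U) (hc : IsPreconnected U)
    {f f' f'' : ℝ → ℝ} (hf : ∀ t ∈ U, HasDerivAt f (f' t) t)
    (hf' : ∀ t ∈ U, HasDerivAt f' (f'' t) t) (hode : ∀ t ∈ U, f t * f'' t = f' t ^ 2)
    (hne : ∀ t ∈ U, f t ≠ 0) {s t : ℝ} (hs : s ∈ U) (ht : t ∈ U) :
    f' t = f' s / f s * f t ∧ f t = f s * Real.exp (f' s / f s * (t - s)) := by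
  have hlog : ∀ x ∈ U, f' x = f' s / f s * f x := by
    have hd : ∀ x ∈ U, HasDerivAt (fun y => f' y / f y) 0 x := fun x hx => by
      refine ((hf' x hx).div (hf x hx) (hne x hx)).congr_deriv ?_
      rw [show f'' x * f x - f' x * f' x = 0 by linarith [hode x hx, sq (f' x)], zero_div]
    intro x hx
    have h : f' x / f x = f' s / f s := hU.is_const_of_deriv_eq_zero hc
      (fun y hy => (hd y hy).differentiableAt.differentiableWithinAt)
      (fun y hy => (hd y hy).deriv) hx hs
    rw [← h, div_mul_cancel₀ _ (hne x hx)]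
  refine ⟨hlog t ht, ?_⟩
  set c := f' s / f s
  have hd : ∀ x ∈ U, HasDerivAt (fun y => f y * Real.exp (-(c * (y - s)))) 0 x := fun x hx => by
    have he : HasDerivAt (fun y => -(c * (y - s))) (-(c * 1)) x :=
      (((hasDerivAt_id x).sub_const s).const_mul c).neg
    refine ((hf x hx).mul he.exp).congr_deriv ?_
    rw [hlog x hx]
    ring
  have h : f t * Real.exp (-(c * (t - s))) = f s * Real.exp (-(c * (s - s))) :=
    hU.is_const_of_deriv_eq_zero hc
      (fun y hy => (hd y hy).differentiableAt.differentiableWithinAt)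
      (fun y hy => (hd y hy).deriv) ht hs
  rw [sub_self, mul_zero, neg_zero, Real.exp_zero, mul_one] at h
  rw [← h, mul_assoc, ← Real.exp_add, neg_add_cancel, Real.exp_zero, mul_one]

theorem statement14 (J : Set ℝ) (hJopen : IsOpen J) (hJint : J.OrdConnected)
    (μ : ℝ → ℝ) (hμ : ContDiffOn ℝ (⊤ : ℕ∞) μ J)
    (hode : ∀ t ∈ J, μ t * deriv (deriv μ) t = (deriv μ t) ^ 2)
    (t₀ : ℝ) (ht₀ : t₀ ∈ J) (h0 : μ t₀ ≠ 0) :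
    (∀ t ∈ J, μ t ≠ 0) ∧
    ∃ c : ℝ, ∀ t ∈ J, μ t = μ t₀ * Real.exp (c * (t - t₀)) := by
  have hd : ∀ t ∈ J, HasDerivAt μ (deriv μ t) t := fun t ht =>
    ((hμ.differentiableOn (by simp)).differentiableAt (hJopen.mem_nhds ht)).hasDerivAt
  have hμ' : ContDiffOn ℝ 1 (deriv μ) J := hμ.deriv_of_isOpen hJopen (by
    rw [one_add_one_eq_two]
    exact WithTop.coe_le_coe.2 (le_top (a := (2 : ℕ∞))))
  have hd' : ∀ t ∈ J, HasDerivAt (deriv μ) (deriv (deriv μ) t) t := fun t ht =>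
    ((hμ'.differentiableOn (by simp)).differentiableAt (hJopen.mem_nhds ht)).hasDerivAt
  set c := deriv μ t₀ / μ t₀ with hc
  let S : Set ℝ := {t | t ∈ J ∧ μ t = μ t₀ * Real.exp (c * (t - t₀)) ∧ deriv μ t = c * μ t}
  have hSopen : IsOpen S := by
    rw [Metric.isOpen_iff]
    rintro s ⟨hsJ, hs, hs'⟩
    have hs0 : μ s ≠ 0 := hs ▸ mul_ne_zero h0 (Real.exp_ne_zero _)
    obtain ⟨ε, hε, hball⟩ := Metric.eventually_nhds_iff_ball.1
      ((hJopen.eventually_mem hsJ).and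
        ((hd s hsJ).continuousAt.eventually_ne hs0))
    refine ⟨ε, hε, fun t ht => ⟨(hball t ht).1, ?_⟩⟩
    obtain ⟨h₁, h₂⟩ := eq_exp_of_mul_deriv_deriv_eq_sq Metric.isOpen_ball
      (convex_ball s ε).isPreconnected (fun x hx => hd x (hball x hx).1)
      (fun x hx => hd' x (hball x hx).1) (fun x hx => hode x (hball x hx).1)
      (fun x hx => (hball x hx).2) (Metric.mem_ball_self hε) ht
    rw [hs', mul_div_cancel_right₀ _ hs0] at h₁ h₂
    refine ⟨?_, h₁⟩
    rw [h₂, hs, mul_assoc, ← Real.exp_add]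
    ring_nf
  have hsub : J ⊆ S := by
    refine hJint.isPreconnected.subset_of_closure_inter_subset hSopen
      ⟨t₀, ht₀, ht₀, by simp, by rw [hc, div_mul_cancel₀ _ h0]⟩ ?_
    rintro t ⟨htS, htJ⟩
    have hcont := (hd t htJ).continuousAt
    have hcont' := (hd' t htJ).continuousAt
    have hfreq := mem_closure_iff_frequently.1 htS
    have hA : ContinuousAt (fun x => μ x - μ t₀ * Real.exp (c * (x - t₀))) t := by fun_prop
    have hB : ContinuousAt (fun x => deriv μ x - c * μ x) t := by fun_prop
    exact ⟨htJ,
      sub_eq_zero.1 (isClosed_singleton.mem_of_frequently_of_tendsto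
        (hfreq.mono fun x hx => sub_eq_zero.2 hx.2.1) hA),
      sub_eq_zero.1 (isClosed_singleton.mem_of_frequently_of_tendsto
        (hfreq.mono fun x hx => sub_eq_zero.2 hx.2.2) hB)⟩
  refine ⟨fun t ht => ?_, c, fun t ht => (hsub ht).2.1⟩
  rw [(hsub ht).2.1]
  exact mul_ne_zero h0 (Real.exp_ne_zero _)
end
end
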